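/- Let 2/3 < β < 3/2, let W satisfy the potential assumption, and let u be a bounded stable solution with |u| ≤ M for some M > 0. Then u has a one-dimensional monotone profile: there exist a unit vector e = (cos α, sin α) with α ∈ (−π/2, π/2) and a nondecreasing function φ : ℝ → [−1, 1] with lim_{s→±∞} φ(s) = ±1, such that u(x) = φ(e · x) for all x ∈ ℝ². In particular |u(x)| ≤ 1 for all x ∈ ℝ². -/

import Mathlib

open Real MeasureTheory Filter Topology Set
open scoped ENNReal NNReal RealInnerProductSpace

noncomputable section

/-- The forcing term `f_β(θ) = (β cos²θ + sin²θ)^(-5/2)`. -/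
def fker (β θ : ℝ) : ℝ := (β * Real.cos θ ^ 2 + Real.sin θ ^ 2) ^ (-(5:ℝ)/2)

/-- `v` is a π-periodic, twice continuously differentiable solution of `v'' + 9 v = f_β`. -/
def IsVBeta (β : ℝ) (v : ℝ → ℝ) : Prop :=
  ContDiff ℝ 2 v ∧ Function.Periodic v π ∧
    ∀ θ : ℝ, deriv (deriv v) θ + 9 * v θ = fker β θ


abbrev R2 : Type := EuclideanSpace ℝ (Fin 2)

/-- The anisotropic kernel `K̄(x) = 9 v(θ(x)) / |x|³`, with `θ(x)` a polar angle of `x`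
(chosen as `Complex.arg`; the choice is immaterial since `v` is π-periodic). -/
def Kbar (v : ℝ → ℝ) (x : R2) : ℝ :=
  9 * v (Complex.arg ((x 0 : ℂ) + (x 1 : ℂ) * Complex.I)) / ‖x‖^3

/-- The nonlocal operator `L̄ g(x) = -(1/(4π)) ∫ (g(x+y)+g(x−y)−2g(x)) K̄(y) dy`. -/
def Lop (v : ℝ → ℝ) (g : R2 → ℝ) (x : R2) : ℝ :=
  -(1/(4*π)) * ∫ y : R2, (g (x + y) + g (x - y) - 2 * g x) * Kbar v y

/-- `D_R = (ℝ²×ℝ²) \ (B_Rᶜ × B_Rᶜ)`. -/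
def DR (R : ℝ) : Set (R2 × R2) := ((Metric.ball (0:R2) R)ᶜ ×ˢ (Metric.ball (0:R2) R)ᶜ)ᶜ

/-- The nonlocal energy `ℰ(u; B_R) = ∬_{D_R} |u(x)−u(y)|² K̄(x−y) dx dy`. -/
def nEnergy (v : ℝ → ℝ) (u : R2 → ℝ) (R : ℝ) : ℝ≥0∞ :=
  ∫⁻ p in DR R, ENNReal.ofReal (|u p.1 - u p.2|^2 * Kbar v (p.1 - p.2))

/-- The potential assumption on `W` with Hölder exponent `α`: `W` is C² and bounded with
bounded first and second derivatives, `W''` is `α`-Hölder for some `α ∈ (0,1)`,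
`W(s) > W(±1)` on `(-1,1)`, and `W''(±1) > 0`. -/
def PotentialAssump (α : ℝ≥0) (W : ℝ → ℝ) : Prop :=
  ContDiff ℝ 2 W ∧ 0 < (α : ℝ) ∧ (α : ℝ) < 1 ∧
  (∃ C, ∀ s, |W s| ≤ C ∧ |deriv W s| ≤ C ∧ |deriv (deriv W) s| ≤ C) ∧
  (∃ Cα : ℝ≥0, HolderWith Cα α (deriv (deriv W))) ∧
  (∀ s ∈ Set.Ioo (-1:ℝ) 1, W 1 < W s ∧ W (-1) < W s) ∧
  0 < deriv (deriv W) 1 ∧ 0 < deriv (deriv W) (-1)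

/-- The point of `ℝ²` with coordinates `(x₁, x₂)`. -/
def pt (x₁ x₂ : ℝ) : R2 := (WithLp.equiv 2 (Fin 2 → ℝ)).symm ![x₁, x₂]

/-- A bounded stable solution of the reduced Peierls–Nabarro equation
`L̄ u = −β^{-1/2} W'(u)` with bi-states at infinity: `u` is C², bounded with bounded
first and second derivatives, solves the equation, satisfies
`lim_{x₁→±∞} u(x₁,x₂) = ±1` for each `x₂`, and the second variation of the energy is
nonnegative on compactly supported C² test functions. -/
def IsStableSolution (β : ℝ) (v W : ℝ → ℝ) (u : R2 → ℝ) : Prop :=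
  ContDiff ℝ 2 u ∧
  (∃ C, ∀ x, |u x| ≤ C ∧ ‖fderiv ℝ u x‖ ≤ C ∧ ‖iteratedFDeriv ℝ 2 u x‖ ≤ C) ∧
  (∀ x, Lop v u x = -(β ^ (-(1:ℝ)/2)) * deriv W (u x)) ∧
  (∀ x₂ : ℝ, Tendsto (fun x₁ => u (pt x₁ x₂)) atTop (𝓝 1) ∧
    Tendsto (fun x₁ => u (pt x₁ x₂)) atBot (𝓝 (-1))) ∧
  (∀ φ : R2 → ℝ, ContDiff ℝ 2 φ → HasCompactSupport φ →
    0 ≤ ∫ x : R2, (Lop v φ x + β ^ (-(1:ℝ)/2) * deriv (deriv W) (u x) * φ x) * φ x)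

/-! ### The kernel -/

lemma quad_angle_pos {β : ℝ} (hβ : 0 < β) (θ : ℝ) : 0 < β * cos θ ^ 2 + sin θ ^ 2 := by
  have h := sin_sq_add_cos_sq θ
  rcases eq_or_ne (sin θ) 0 with h0 | h0
  · have : cos θ ^ 2 = 1 := by nlinarith
    rw [this, h0]; simpa using hβ
  · have := sq_pos_of_ne_zero h0
    positivity

lemma hasDerivAt_quad_rpow {β : ℝ} (hβ : 0 < β) (θ : ℝ) :
    HasDerivAt (fun θ => (β * cos θ ^ 2 + sin θ ^ 2) ^ (-(3:ℝ)/2))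
      (-3 * (1 - β) * sin θ * cos θ * fker β θ) θ := by
  have hq := quad_angle_pos hβ θ
  have h1 : HasDerivAt (fun θ => β * cos θ ^ 2 + sin θ ^ 2)
      (2 * (1 - β) * sin θ * cos θ) θ := by
    have := (((hasDerivAt_cos θ).pow 2).const_mul β).add ((hasDerivAt_sin θ).pow 2)
    convert! this using 1
    simp; ring
  have h2 := h1.rpow_const (p := -(3:ℝ)/2) (Or.inl hq.ne')
  convert! h2 using 1
  rw [fker, show (-(3:ℝ)/2 - 1) = -(5:ℝ)/2 by norm_num]
  ring

lemma quad_rpow_eq {β : ℝ} (hβ : 0 < β) (θ : ℝ) :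
    (β * cos θ ^ 2 + sin θ ^ 2) ^ (-(3:ℝ)/2) = (β * cos θ ^ 2 + sin θ ^ 2) * fker β θ := by
  have hq := quad_angle_pos hβ θ
  rw [fker, show (-(3:ℝ)/2) = 1 + -(5:ℝ)/2 by norm_num, rpow_add hq, rpow_one]

/-- The polynomial whose quotient by `(βT+S)^{3/2}` gives the angular profile. -/
def angPoly (β T S : ℝ) : ℝ :=
  (3*β-2) * S^3 + (9*β^2-12*β+6) * S^2*T + 3*β*(2*β^2-4*β+3) * S*T^2 + β^2*(3-2*β) * T^3

lemma angPoly_pos {β T S : ℝ} (hβ1 : 2/3 < β) (hβ2 : β < 3/2) (hT : 0 ≤ T) (hS : 0 ≤ S)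
    (hTS : 0 < T + S) : 0 < angPoly β T S := by
  have hβ : 0 < β := by linarith
  have c1 : 0 < 3*β-2 := by linarith
  have c2 : 0 < 9*β^2-12*β+6 := by nlinarith [sq_nonneg (3*β-2)]
  have c3 : 0 < 3*β*(2*β^2-4*β+3) := by
    have : 0 < 2*β^2-4*β+3 := by nlinarith [sq_nonneg (β-1)]
    positivity
  have c4 : 0 < β^2*(3-2*β) := by
    have : 0 < 3-2*β := by linarith
    positivity
  unfold angPoly
  rcases hT.eq_or_lt with h | h
  · subst h
    have : 0 < S := by linarith
    positivity
  · positivity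

lemma hasDerivAt_sine_primitive {β : ℝ} (hβ : 0 < β) (θ : ℝ) :
    HasDerivAt (fun θ => (β * cos θ ^ 2 + sin θ ^ 2) ^ (-(3:ℝ)/2) *
      (cos θ * (3 + (2*β-6) * cos θ ^ 2) / 3)) (sin (3*θ) * fker β θ) θ := by
  have h1 : HasDerivAt (fun θ => cos θ * (3 + (2*β-6) * cos θ ^ 2) / 3)
      (-sin θ * (1 + (2*β-6) * cos θ ^ 2)) θ := by
    have := (((hasDerivAt_cos θ).mul
      ((((hasDerivAt_cos θ).pow 2).const_mul (2*β-6)).const_add 3)).div_const 3)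
    convert! this using 1
    simp; ring
  convert! (hasDerivAt_quad_rpow hβ θ).mul h1 using 1
  rw [quad_rpow_eq hβ, sin_three_mul]
  have hc : cos θ ^ 2 = 1 - sin θ ^ 2 := by linarith [sin_sq_add_cos_sq θ]
  linear_combination (sin θ * fker β θ) * (-3 + (2*β-6) * cos θ ^ 2) * hc

lemma hasDerivAt_cosine_primitive {β : ℝ} (hβ : 0 < β) (θ : ℝ) :
    HasDerivAt (fun θ => (β * cos θ ^ 2 + sin θ ^ 2) ^ (-(3:ℝ)/2) *
      (sin θ * (3*β + (2-6*β) * sin θ ^ 2) / (3*β^2))) (cos (3*θ) * fker β θ) θ := by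
  have h1 : HasDerivAt (fun θ => sin θ * (3*β + (2-6*β) * sin θ ^ 2) / (3*β^2))
      (cos θ * (β + (2-6*β) * sin θ ^ 2) / β^2) θ := by
    have := (((hasDerivAt_sin θ).mul
      ((((hasDerivAt_sin θ).pow 2).const_mul (2-6*β)).const_add (3*β))).div_const (3*β^2))
    convert! this using 1
    simp; field_simp; ring
  convert! (hasDerivAt_quad_rpow hβ θ).mul h1 using 1
  rw [quad_rpow_eq hβ, cos_three_mul]
  have hc : cos θ ^ 2 = 1 - sin θ ^ 2 := by linarith [sin_sq_add_cos_sq θ]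
  have hb : β ≠ 0 := hβ.ne'
  have : (4 * cos θ ^ 3 - 3 * cos θ) * fker β θ =
      (4 * cos θ ^ 3 - 3 * cos θ) * fker β θ * β ^ 2 / β ^ 2 := by field_simp
  rw [this]
  have h3 : sin θ * (3*β + (2-6*β) * sin θ ^ 2) / (3*β^2) =
    sin θ * (β + (2/3-2*β) * sin θ ^ 2) / β^2 := by field_simp; ring
  rw [h3]
  linear_combination (cos θ * fker β θ / β^2) * (3*β^2 - (2-6*β) * β * sin θ ^ 2) * hc

/-- Variation of constants: the explicit form of the angular profile. -/
lemma IsVBeta.eq_angPoly {β : ℝ} (hβ : 0 < β) {v : ℝ → ℝ} (hv : IsVBeta β v) (θ : ℝ) :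
    v θ = (β * cos θ ^ 2 + sin θ ^ 2) ^ (-(3:ℝ)/2) *
      angPoly β (cos θ ^ 2) (sin θ ^ 2) / (9*β^2) := by
  obtain ⟨hv2, hper, hode⟩ := hv
  have hd : ∀ θ, HasDerivAt v (deriv v θ) θ := fun θ =>
    (hv2.differentiable (by norm_num) θ).hasDerivAt
  have hdd : ∀ θ, HasDerivAt (deriv v) (fker β θ - 9 * v θ) θ := fun θ => by
    have h1 : ContDiff ℝ 1 (deriv v) :=
      ((contDiff_succ_iff_deriv (n := 1)).1 (by simpa [one_add_one_eq_two] using hv2)).2.2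
    have := (h1.differentiable (by norm_num) θ).hasDerivAt
    rwa [show deriv (deriv v) θ = fker β θ - 9 * v θ by linarith [hode θ]] at this
  have hperd : ∀ θ, deriv v (θ + π) = deriv v θ := fun θ => by
    have : (fun x => v (x + π)) = v := funext hper
    rw [← deriv_comp_add_const, this]
  have hs3 : ∀ θ : ℝ, HasDerivAt (fun θ => sin (3*θ)) (3 * cos (3*θ)) θ := fun θ => by
    have := (hasDerivAt_id θ).const_mul 3 |>.sin
    convert! this using 1
    simp; ring
  have hc3 : ∀ θ : ℝ, HasDerivAt (fun θ => cos (3*θ)) (-(3 * sin (3*θ))) θ := fun θ => by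
    have := (hasDerivAt_id θ).const_mul 3 |>.cos
    convert! this using 1
    simp; ring
  have sπ : ∀ θ : ℝ, sin (3*(θ+π)) = - sin (3*θ) := fun θ => by
    rw [sin_three_mul, sin_three_mul, sin_add_pi]; ring
  have cπ : ∀ θ : ℝ, cos (3*(θ+π)) = - cos (3*θ) := fun θ => by
    rw [cos_three_mul, cos_three_mul, cos_add_pi]; ring
  have antiper : ∀ F : ℝ → ℝ, (∀ θ, HasDerivAt F 0 θ) → (∀ θ, F (θ + π) = - F θ) →
      ∀ θ, F θ = 0 := fun F hF hFa θ => by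
    have := is_const_of_deriv_eq_zero (fun θ => (hF θ).differentiableAt)
      (fun θ => (hF θ).deriv) (θ + π) θ
    linarith [hFa θ]
  have hA := antiper (fun θ => v θ * cos (3*θ) - deriv v θ / 3 * sin (3*θ) +
    ((β * cos θ ^ 2 + sin θ ^ 2) ^ (-(3:ℝ)/2) *
      (cos θ * (3 + (2*β-6) * cos θ ^ 2) / 3)) / 3) (fun θ => by
      have := (((hd θ).mul (hc3 θ)).sub (((hdd θ).div_const 3).mul (hs3 θ))).add
        ((hasDerivAt_sine_primitive hβ θ).div_const 3)
      convert! this using 1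
      ring) (fun θ => by
      simp only [hper θ, hperd θ, sπ, cπ, cos_add_pi, sin_add_pi, neg_sq]; ring) θ
  have hB := antiper (fun θ => v θ * sin (3*θ) + deriv v θ / 3 * cos (3*θ) -
    ((β * cos θ ^ 2 + sin θ ^ 2) ^ (-(3:ℝ)/2) *
      (sin θ * (3*β + (2-6*β) * sin θ ^ 2) / (3*β^2))) / 3) (fun θ => by
      have := (((hd θ).mul (hs3 θ)).add (((hdd θ).div_const 3).mul (hc3 θ))).sub
        ((hasDerivAt_cosine_primitive hβ θ).div_const 3)
      convert! this using 1
      ring) (fun θ => by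
      simp only [hper θ, hperd θ, sπ, cπ, cos_add_pi, sin_add_pi, neg_sq]; ring) θ
  generalize (β * cos θ ^ 2 + sin θ ^ 2) ^ (-(3:ℝ)/2) = Q at *
  have h1 : v θ = - Q * (cos θ * (3 + (2*β-6) * cos θ ^ 2) / 9) * cos (3*θ) +
      Q * (sin θ * (3*β + (2-6*β) * sin θ ^ 2) / (9*β^2)) * sin (3*θ) := by
    have e := sin_sq_add_cos_sq (3*θ)
    have e2 : sin θ * (3*β + (2-6*β) * sin θ ^ 2) / (9*β^2) =
      sin θ * (3*β + (2-6*β) * sin θ ^ 2) / (3*β^2) / 3 := by field_simp; ring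
    rw [e2]
    linear_combination (- v θ) * e + cos (3*θ) * hA + sin (3*θ) * hB
  rw [h1, cos_three_mul, sin_three_mul, angPoly]
  have hc := sin_sq_add_cos_sq θ
  have e1 : 3 + (2*β-6) * cos θ ^ 2 = 3 * sin θ ^ 2 + (2*β-3) * cos θ ^ 2 := by
    linear_combination (-3) * hc
  have e2 : 4 * cos θ ^ 3 - 3 * cos θ = cos θ * (cos θ ^ 2 - 3 * sin θ ^ 2) := by
    linear_combination (3 * cos θ) * hc
  have e3 : 3*β + (2-6*β) * sin θ ^ 2 = 3*β*cos θ ^ 2 + (2-3*β) * sin θ ^ 2 := by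
    linear_combination (-3*β) * hc
  have e4 : 3 * sin θ - 4 * sin θ ^ 3 = sin θ * (3 * cos θ ^ 2 - sin θ ^ 2) := by
    linear_combination (-3 * sin θ) * hc
  rw [e1, e2, e3, e4]
  field_simp
  ring

lemma norm_sq_R2 (y : R2) : ‖y‖ ^ 2 = y 0 ^ 2 + y 1 ^ 2 := by
  rw [EuclideanSpace.norm_sq_eq]; simp

lemma Kbar_eq {β : ℝ} (hβ : 0 < β) {v : ℝ → ℝ} (hv : IsVBeta β v) {y : R2} (hy : y ≠ 0) :
    Kbar v y = angPoly β (y 0 ^ 2) (y 1 ^ 2) / β ^ 2 *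
      (β * y 0 ^ 2 + y 1 ^ 2) ^ (-(3:ℝ)/2) / (‖y‖ ^ 2) ^ 3 := by
  have hn : 0 < ‖y‖ := norm_pos_iff.2 hy
  have hsq := norm_sq_R2 y
  set z : ℂ := (y 0 : ℂ) + (y 1 : ℂ) * Complex.I with hz
  have hzn : ‖z‖ = ‖y‖ := by
    have : ‖z‖ ^ 2 = ‖y‖ ^ 2 := by
      rw [hsq, Complex.sq_norm, hz, Complex.normSq_add_mul_I]
    exact (sq_eq_sq₀ (norm_nonneg _) (norm_nonneg _)).1 this
  have hz0 : z ≠ 0 := by rw [← norm_pos_iff, hzn]; exact hn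
  have hc : cos (Complex.arg z) = y 0 / ‖y‖ := by
    rw [Complex.cos_arg hz0, hzn]; simp [hz]
  have hs : sin (Complex.arg z) = y 1 / ‖y‖ := by
    rw [Complex.sin_arg, hzn]; simp [hz]
  have hA : 0 ≤ β * y 0 ^ 2 + y 1 ^ 2 := by positivity
  rw [Kbar, ← hz, hv.eq_angPoly hβ, hc, hs]
  have h1 : β * (y 0 / ‖y‖) ^ 2 + (y 1 / ‖y‖) ^ 2 = (β * y 0 ^ 2 + y 1 ^ 2) * (‖y‖ ^ 2)⁻¹ := by
    field_simp
  have h2 : ((‖y‖ ^ 2)⁻¹) ^ (-(3:ℝ)/2) = ‖y‖ ^ 3 := by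
    rw [inv_rpow (by positivity), neg_div, rpow_neg (by positivity), inv_inv,
      ← rpow_natCast ‖y‖ 2, ← rpow_mul hn.le]
    norm_num
  rw [h1, mul_rpow hA (by positivity), h2]
  have h3 : angPoly β ((y 0 / ‖y‖) ^ 2) ((y 1 / ‖y‖) ^ 2) =
      angPoly β (y 0 ^ 2) (y 1 ^ 2) / (‖y‖ ^ 2) ^ 3 := by
    unfold angPoly
    field_simp
  rw [h3]
  field_simp

lemma Kbar_pos {β : ℝ} (hβ1 : 2/3 < β) (hβ2 : β < 3/2) {v : ℝ → ℝ} (hv : IsVBeta β v) {y : R2}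
    (hy : y ≠ 0) : 0 < Kbar v y := by
  have hβ : 0 < β := by linarith
  rw [Kbar_eq hβ hv hy]
  have hn : 0 < ‖y‖ := norm_pos_iff.2 hy
  have hs : 0 < y 0 ^ 2 + y 1 ^ 2 := by rw [← norm_sq_R2]; positivity
  have h1 := angPoly_pos hβ1 hβ2 (sq_nonneg (y 0)) (sq_nonneg (y 1)) hs
  have h2 : 0 < β * y 0 ^ 2 + y 1 ^ 2 := by
    nlinarith [sq_nonneg (y 0), sq_nonneg (y 1)]
  positivity

lemma Kbar_zero (v : ℝ → ℝ) : Kbar v 0 = 0 := by simp [Kbar]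

lemma Kbar_nonneg {β : ℝ} (hβ1 : 2/3 < β) (hβ2 : β < 3/2) {v : ℝ → ℝ} (hv : IsVBeta β v)
    (y : R2) : 0 ≤ Kbar v y := by
  rcases eq_or_ne y 0 with rfl | hy
  · rw [Kbar_zero]
  · exact (Kbar_pos hβ1 hβ2 hv hy).le

lemma Kbar_le {β : ℝ} {v : ℝ → ℝ} (hv : IsVBeta β v) :
    ∃ Λ : ℝ, 0 ≤ Λ ∧ ∀ y, |Kbar v y| ≤ Λ / ‖y‖ ^ 3 := by
  obtain ⟨C, hC⟩ := (isCompact_Icc (a := -π) (b := π)).exists_bound_of_continuousOn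
    hv.1.continuous.continuousOn
  have hC0 : 0 ≤ C := (norm_nonneg _).trans (hC 0 ⟨by linarith [pi_pos], pi_pos.le⟩)
  refine ⟨9 * C, by positivity, fun y => ?_⟩
  rw [Kbar, abs_div, abs_mul, abs_of_nonneg (by positivity : 0 ≤ ‖y‖ ^ 3)]
  gcongr
  · simp
  · exact hC _ ⟨(Complex.neg_pi_lt_arg _).le, Complex.arg_le_pi _⟩

lemma measurable_Kbar {v : ℝ → ℝ} (hv : Continuous v) : Measurable (Kbar v) := by
  unfold Kbar
  refine Measurable.div (Measurable.const_mul (hv.measurable.comp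
    (Complex.measurable_arg.comp ?_)) 9) (by fun_prop)
  exact Continuous.measurable (by fun_prop)

/-! ### Symbols: functions with power-type bounds on two line derivatives -/

/-- `f1`, `f2` are the first two derivatives of `f` in direction `d`, and `f`, `f1`, `f2` are
bounded by powers of `1 + ‖y‖²` of order `m`, `m - 1`, `m - 2` respectively. -/
structure IsSymbol (d : R2) (m : ℝ) (f f1 f2 : R2 → ℝ) : Prop where
  cont : Continuous f
  cont1 : Continuous f1
  cont2 : Continuous f2
  deriv1 : ∀ y, HasLineDerivAt ℝ f (f1 y) y d
  deriv2 : ∀ y, HasLineDerivAt ℝ f1 (f2 y) y d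
  bound : ∃ C, 0 ≤ C ∧ ∀ y, |f y| ≤ C * (1 + ‖y‖ ^ 2) ^ (m / 2)
  bound1 : ∃ C, 0 ≤ C ∧ ∀ y, |f1 y| ≤ C * (1 + ‖y‖ ^ 2) ^ ((m - 1) / 2)
  bound2 : ∃ C, 0 ≤ C ∧ ∀ y, |f2 y| ≤ C * (1 + ‖y‖ ^ 2) ^ ((m - 2) / 2)

lemma bound_mul {m n : ℝ} {f g : R2 → ℝ}
    (hf : ∃ C, 0 ≤ C ∧ ∀ y, |f y| ≤ C * (1 + ‖y‖ ^ 2) ^ (m / 2))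
    (hg : ∃ C, 0 ≤ C ∧ ∀ y, |g y| ≤ C * (1 + ‖y‖ ^ 2) ^ (n / 2)) {k : ℝ} (hk : k = m + n) :
    ∃ C, 0 ≤ C ∧ ∀ y, |f y * g y| ≤ C * (1 + ‖y‖ ^ 2) ^ (k / 2) := by
  obtain ⟨A, hA, hf⟩ := hf
  obtain ⟨B, hB, hg⟩ := hg
  refine ⟨A * B, by positivity, fun y => ?_⟩
  rw [abs_mul, hk, add_div, rpow_add (by positivity)]
  calc |f y| * |g y| ≤ (A * (1 + ‖y‖ ^ 2) ^ (m / 2)) * (B * (1 + ‖y‖ ^ 2) ^ (n / 2)) := by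
        gcongr; exacts [hf y, hg y]
    _ = _ := by ring

lemma bound_add {m : ℝ} {f g : R2 → ℝ}
    (hf : ∃ C, 0 ≤ C ∧ ∀ y, |f y| ≤ C * (1 + ‖y‖ ^ 2) ^ (m / 2))
    (hg : ∃ C, 0 ≤ C ∧ ∀ y, |g y| ≤ C * (1 + ‖y‖ ^ 2) ^ (m / 2)) :
    ∃ C, 0 ≤ C ∧ ∀ y, |f y + g y| ≤ C * (1 + ‖y‖ ^ 2) ^ (m / 2) := by
  obtain ⟨A, hA, hf⟩ := hf
  obtain ⟨B, hB, hg⟩ := hg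
  refine ⟨A + B, by positivity, fun y => ?_⟩
  calc _ ≤ |f y| + |g y| := abs_add_le _ _
    _ ≤ _ := by rw [add_mul]; exact add_le_add (hf y) (hg y)

lemma bound_const_mul {m : ℝ} (c : ℝ) {f : R2 → ℝ}
    (hf : ∃ C, 0 ≤ C ∧ ∀ y, |f y| ≤ C * (1 + ‖y‖ ^ 2) ^ (m / 2)) :
    ∃ C, 0 ≤ C ∧ ∀ y, |c * f y| ≤ C * (1 + ‖y‖ ^ 2) ^ (m / 2) := by
  obtain ⟨A, hA, hf⟩ := hf
  refine ⟨|c| * A, by positivity, fun y => ?_⟩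
  rw [abs_mul, mul_assoc]
  gcongr
  exact hf y

lemma IsSymbol.mul {d : R2} {m n : ℝ} {f f1 f2 g g1 g2 : R2 → ℝ} (hf : IsSymbol d m f f1 f2)
    (hg : IsSymbol d n g g1 g2) :
    IsSymbol d (m + n) (fun y => f y * g y) (fun y => f1 y * g y + f y * g1 y)
      (fun y => (f2 y * g y + f1 y * g1 y) + (f1 y * g1 y + f y * g2 y)) := by
  refine ⟨hf.cont.mul hg.cont, (hf.cont1.mul hg.cont).add (hf.cont.mul hg.cont1),
    ((hf.cont2.mul hg.cont).add (hf.cont1.mul hg.cont1)).add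
      ((hf.cont1.mul hg.cont1).add (hf.cont.mul hg.cont2)), fun y => ?_, fun y => ?_,
    bound_mul hf.bound hg.bound rfl, ?_, ?_⟩
  · have := HasDerivAt.mul (hf.deriv1 y) (hg.deriv1 y)
    simpa [HasLineDerivAt] using! this
  · have := (HasDerivAt.mul (hf.deriv2 y) (hg.deriv1 y)).add
      (HasDerivAt.mul (hf.deriv1 y) (hg.deriv2 y))
    simpa [HasLineDerivAt] using! this
  · exact bound_add (bound_mul hf.bound1 hg.bound (by ring))
      (bound_mul hf.bound hg.bound1 (by ring))
  · exact bound_add (bound_add (bound_mul hf.bound2 hg.bound (by ring))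
      (bound_mul hf.bound1 hg.bound1 (by ring)))
      (bound_add (bound_mul hf.bound1 hg.bound1 (by ring))
      (bound_mul hf.bound hg.bound2 (by ring)))

lemma IsSymbol.add {d : R2} {m : ℝ} {f f1 f2 g g1 g2 : R2 → ℝ} (hf : IsSymbol d m f f1 f2)
    (hg : IsSymbol d m g g1 g2) :
    IsSymbol d m (fun y => f y + g y) (fun y => f1 y + g1 y) (fun y => f2 y + g2 y) :=
  ⟨hf.cont.add hg.cont, hf.cont1.add hg.cont1, hf.cont2.add hg.cont2,
    fun y => HasDerivAt.add (hf.deriv1 y) (hg.deriv1 y),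
    fun y => HasDerivAt.add (hf.deriv2 y) (hg.deriv2 y),
    bound_add hf.bound hg.bound, bound_add hf.bound1 hg.bound1, bound_add hf.bound2 hg.bound2⟩

lemma IsSymbol.const_mul {d : R2} {m : ℝ} {f f1 f2 : R2 → ℝ} (c : ℝ)
    (hf : IsSymbol d m f f1 f2) :
    IsSymbol d m (fun y => c * f y) (fun y => c * f1 y) (fun y => c * f2 y) :=
  ⟨hf.cont.const_mul c, hf.cont1.const_mul c, hf.cont2.const_mul c,
    fun y => HasDerivAt.const_mul c (hf.deriv1 y),
    fun y => HasDerivAt.const_mul c (hf.deriv2 y),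
    bound_const_mul c hf.bound, bound_const_mul c hf.bound1, bound_const_mul c hf.bound2⟩

lemma IsSymbol.congr {d : R2} {m : ℝ} {f g f1 f2 : R2 → ℝ} (hf : IsSymbol d m f f1 f2)
    (h : ∀ y, g y = f y) : IsSymbol d m g f1 f2 := by
  rwa [funext h]

lemma isSymbol_coord (d : R2) (i : Fin 2) :
    IsSymbol d 1 (fun y => y i) (fun _ => d i) (fun _ => 0) := by
  refine ⟨by fun_prop, by fun_prop, by fun_prop, fun y => ?_, fun y => ?_,
    ⟨1, zero_le_one, fun y => ?_⟩, ⟨|d i|, abs_nonneg _, fun y => ?_⟩, ⟨0, le_rfl, by simp⟩⟩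
  · have : HasDerivAt (fun t : ℝ => y i + t * d i) (d i) 0 := by
      simpa using ((hasDerivAt_id (0:ℝ)).mul_const (d i)).const_add (y i)
    simpa [HasLineDerivAt] using! this
  · exact hasDerivAt_const _ _
  · rw [one_mul, ← sqrt_eq_rpow]
    apply abs_le_sqrt
    have : ‖y i‖ ≤ ‖y‖ := PiLp.norm_apply_le y i
    have h2 : (y i) ^ 2 ≤ ‖y‖ ^ 2 := by
      rw [← sq_abs]; exact pow_le_pow_left₀ (abs_nonneg _) this 2
    linarith
  · simp

lemma isSymbol_const (d : R2) {m : ℝ} (hm : 0 ≤ m) (c : ℝ) :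
    IsSymbol d m (fun _ => c) (fun _ => 0) (fun _ => 0) := by
  refine ⟨by fun_prop, by fun_prop, by fun_prop, fun y => hasDerivAt_const _ _,
    fun y => hasDerivAt_const _ _, ⟨|c|, abs_nonneg _, fun y => ?_⟩, ⟨0, le_rfl, by simp⟩,
    ⟨0, le_rfl, by simp⟩⟩
  have : 1 ≤ (1 + ‖y‖ ^ 2) ^ (m / 2) :=
    one_le_rpow (by nlinarith [sq_nonneg ‖y‖]) (by positivity)
  nlinarith [abs_nonneg c]

lemma bound_rpow {a : R2 → ℝ} {c : ℝ} (hc : 0 < c) (ha : ∀ y, c * (1 + ‖y‖ ^ 2) ≤ a y) {s k : ℝ}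
    (hs : s ≤ 0) (hk : k = 2 * s) :
    ∃ C, 0 ≤ C ∧ ∀ y, |a y ^ s| ≤ C * (1 + ‖y‖ ^ 2) ^ (k / 2) := by
  refine ⟨c ^ s, by positivity, fun y => ?_⟩
  have h0 : 0 < c * (1 + ‖y‖ ^ 2) := by positivity
  rw [abs_of_nonneg (rpow_nonneg (h0.le.trans (ha y)) _), hk,
    show 2 * s / 2 = s by ring, ← mul_rpow hc.le (by positivity)]
  exact rpow_le_rpow_of_nonpos h0 (ha y) hs

lemma IsSymbol.rpow {d : R2} {a a1 a2 : R2 → ℝ} (ha : IsSymbol d 2 a a1 a2) {c : ℝ} (hc : 0 < c)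
    (hac : ∀ y, c * (1 + ‖y‖ ^ 2) ≤ a y) {s : ℝ} (hs : s ≤ 0) :
    IsSymbol d (2 * s) (fun y => a y ^ s) (fun y => a1 y * s * a y ^ (s - 1))
      (fun y => (a2 y * s) * a y ^ (s - 1) +
        (a1 y * s) * (a1 y * (s - 1) * a y ^ (s - 1 - 1))) := by
  have hpos : ∀ y, 0 < a y := fun y => lt_of_lt_of_le (by positivity) (hac y)
  have hcr : ∀ r : ℝ, Continuous fun y => a y ^ r := fun r =>
    ha.cont.rpow_const fun y => Or.inl (hpos y).ne'
  have hdr : ∀ (r : ℝ) y, HasLineDerivAt ℝ (fun y => a y ^ r) (a1 y * r * a y ^ (r - 1)) y d := by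
    intro r y
    have := HasDerivAt.rpow_const (ha.deriv1 y) (p := r) (Or.inl (by simpa using (hpos y).ne'))
    simpa [HasLineDerivAt] using! this
  have b1 : ∃ C, 0 ≤ C ∧ ∀ y, |a1 y * s| ≤ C * (1 + ‖y‖ ^ 2) ^ ((1 : ℝ) / 2) := by
    have := bound_const_mul s ha.bound1
    norm_num [mul_comm s] at this ⊢
    exact this
  have b1' : ∃ C, 0 ≤ C ∧ ∀ y, |a1 y * (s - 1)| ≤ C * (1 + ‖y‖ ^ 2) ^ ((1 : ℝ) / 2) := by
    have := bound_const_mul (s-1) ha.bound1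
    norm_num [mul_comm (s-1)] at this ⊢
    exact this
  have b2 : ∃ C, 0 ≤ C ∧ ∀ y, |a2 y * s| ≤ C * (1 + ‖y‖ ^ 2) ^ ((0 : ℝ) / 2) := by
    have := bound_const_mul s ha.bound2
    norm_num [mul_comm s] at this ⊢
    exact this
  refine ⟨hcr s, (ha.cont1.mul_const s).mul (hcr _), ?_, hdr s, fun y => ?_,
    bound_rpow hc hac hs rfl, ?_, ?_⟩
  · exact ((ha.cont2.mul_const s).mul (hcr _)).add
      ((ha.cont1.mul_const s).mul ((ha.cont1.mul_const _).mul (hcr _)))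
  · have := HasDerivAt.mul (HasDerivAt.mul_const (ha.deriv2 y) s) (hdr (s-1) y)
    simpa [HasLineDerivAt] using! this
  · exact bound_mul b1 (bound_rpow hc hac (by linarith) rfl) (by ring)
  · exact bound_add (bound_mul b2 (bound_rpow hc hac (by linarith) rfl) (by ring))
      (bound_mul b1 (bound_mul b1' (bound_rpow hc hac (by linarith) rfl) rfl) (by ring))

/-- The kernel regularized at the origin by replacing `|y|²` with `1 + |y|²` in denominators. -/
def smoothKbar (β : ℝ) (y : R2) : ℝ :=
  angPoly β (y 0 ^ 2) (y 1 ^ 2) / β ^ 2 * (1 + (β * y 0 ^ 2 + y 1 ^ 2)) ^ (-3 / 2 : ℝ) *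
    (1 + ‖y‖ ^ 2) ^ (-3 : ℝ)

lemma exists_isSymbol_smoothKbar {β : ℝ} (hβ1 : 2/3 < β) (d : R2) :
    ∃ K₂' K₂'' : R2 → ℝ, IsSymbol d (-3) (smoothKbar β) K₂' K₂'' := by
  have x0 := isSymbol_coord d 0
  have x1 := isSymbol_coord d 1
  have T := x0.mul x0
  have S := x1.mul x1
  have hN := (((((S.mul S).mul S).const_mul (3*β-2)).add
    (((S.mul S).mul T).const_mul (9*β^2-12*β+6))).add
    ((S.mul (T.mul T)).const_mul (3*β*(2*β^2-4*β+3)) |> fun h => by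
      rw [show (1 + 1 + (1 + 1 + (1 + 1)) : ℝ) = 1 + 1 + (1 + 1) + (1 + 1) by ring] at h
      exact h)).add
    (((T.mul T).mul T).const_mul (β^2*(3-2*β)))
  have hA := ((isSymbol_const d (show (0:ℝ) ≤ 1 + 1 by norm_num) 1).add (T.const_mul β)).add S
  have hB := ((isSymbol_const d (show (0:ℝ) ≤ 1 + 1 by norm_num) 1).add T).add S
  rw [one_add_one_eq_two] at hA hB
  have hA' := hA.rpow (c := 2/3) (by norm_num) (fun y => by
    rw [norm_sq_R2]; nlinarith [sq_nonneg (y 0), sq_nonneg (y 1)]) (s := -3/2) (by norm_num)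
  have hB' := hB.rpow (c := 1) (by norm_num) (fun y => by
    rw [norm_sq_R2]; nlinarith [sq_nonneg (y 0), sq_nonneg (y 1)]) (s := -3) (by norm_num)
  have hK := ((hN.mul hA').mul hB').const_mul (1 / β ^ 2)
  rw [show (1 + 1 + (1 + 1) + (1 + 1) + 2 * (-3 / 2) + 2 * (-3) : ℝ) = -3 by norm_num] at hK
  refine ⟨_, _, hK.congr fun y => ?_⟩
  have e1 : 1 + β * (y 0 * y 0) + y 1 * y 1 = 1 + (β * y 0 ^ 2 + y 1 ^ 2) := by ring
  have e2 : 1 + y 0 * y 0 + y 1 * y 1 = 1 + ‖y‖ ^ 2 := by rw [norm_sq_R2]; ring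
  rw [e1, e2, smoothKbar, angPoly]
  ring

lemma abs_Kbar_sub_smoothKbar_le {β : ℝ} (hβ1 : 2/3 < β) (hβ2 : β < 3/2) {v : ℝ → ℝ}
    (hv : IsVBeta β v) (y : R2) :
    |Kbar v y - smoothKbar β y| ≤ 6 * Kbar v y / (1 + ‖y‖ ^ 2) := by
  have hβ : 0 < β := by linarith
  rcases eq_or_ne y 0 with rfl | hy
  · simp [Kbar_zero, smoothKbar, angPoly]
  have hn : 0 < ‖y‖ := norm_pos_iff.2 hy
  have hKpos := Kbar_pos hβ1 hβ2 hv hy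
  have hsq := norm_sq_R2 y
  set A : ℝ := β * y 0 ^ 2 + y 1 ^ 2 with hAdef
  set B : ℝ := ‖y‖ ^ 2 with hBdef
  have hB0 : 0 < B := by positivity
  have hAB : 2/3 * B ≤ A := by rw [hsq]; nlinarith [sq_nonneg (y 0), sq_nonneg (y 1)]
  have hA0 : 0 < A := by linarith
  set P := (A / (1 + A)) ^ ((3:ℝ)/2) * (B / (1 + B)) ^ 3 with hP
  have hp1 : 0 ≤ A / (1 + A) := by positivity
  have hp2 : A / (1 + A) ≤ 1 := by rw [div_le_one (by positivity)]; linarith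
  have hq1 : 0 ≤ B / (1 + B) := by positivity
  have hq2 : B / (1 + B) ≤ 1 := by rw [div_le_one (by positivity)]; linarith
  have hP1 : P ≤ 1 := mul_le_one₀ (rpow_le_one hp1 hp2 (by norm_num)) (by positivity)
    (pow_le_one₀ hq1 hq2)
  have hP2 : 1 - 6 / (1 + B) ≤ P := by
    have h1 : (A / (1 + A)) ^ 2 ≤ (A / (1 + A)) ^ ((3:ℝ)/2) := by
      rw [← rpow_natCast]
      exact rpow_le_rpow_of_exponent_ge (by positivity) hp2 (by norm_num)
    have h2 : (A / (1 + A)) ^ 2 * (B / (1 + B)) ^ 3 ≤ P :=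
      mul_le_mul_of_nonneg_right h1 (by positivity)
    have ha : A / (1 + A) = 1 - 1 / (1 + A) := by field_simp; ring
    have hb : B / (1 + B) = 1 - 1 / (1 + B) := by field_simp; ring
    have h3 : 1 / (1 + A) ≤ (3/2) * (1 / (1 + B)) := by
      rw [div_le_iff₀ (by positivity)]
      field_simp
      nlinarith
    have h4 : 1 - 2 * (1 / (1 + A)) ≤ (A / (1 + A)) ^ 2 := by
      rw [ha]
      nlinarith [sq_nonneg (1 / (1 + A))]
    have h5 : 1 - 3 * (1 / (1 + B)) ≤ (B / (1 + B)) ^ 3 := by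
      have := one_add_mul_le_pow (a := -(1 / (1+B))) (by rw [hb] at hq1; linarith) 3
      rw [hb]; push_cast at this; linarith
    have h6 : (A / (1 + A)) ^ 2 ≤ 1 := pow_le_one₀ hp1 hp2
    have h7 : (B / (1 + B)) ^ 3 ≤ 1 := pow_le_one₀ hq1 hq2
    have h8 : 6 / (1 + B) = 6 * (1 / (1 + B)) := by ring
    nlinarith [mul_nonneg (sub_nonneg.2 h6) (sub_nonneg.2 h7)]
  have key : Kbar v y - Kbar v y * P = Kbar v y * (1 - P) := by ring
  have hK2 : smoothKbar β y = Kbar v y * P := by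
    rw [smoothKbar, ← hAdef, ← hBdef, Kbar_eq hβ hv hy, hP, div_rpow hA0.le (by positivity),
      ← hAdef, ← hBdef, neg_div, rpow_neg hA0.le, rpow_neg (by positivity : 0 ≤ 1 + A),
      rpow_neg (by positivity : 0 ≤ 1 + B), show (3:ℝ) = ((3:ℕ):ℝ) by norm_num, rpow_natCast]
    have := rpow_pos_of_pos hA0 (((3:ℕ):ℝ)/2)
    have := rpow_pos_of_pos (by positivity : 0 < 1 + A) (((3:ℕ):ℝ)/2)
    field_simp
  rw [hK2, key, abs_of_nonneg (mul_nonneg hKpos.le (by linarith))]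
  calc _ ≤ Kbar v y * (6 / (1 + B)) := mul_le_mul_of_nonneg_left (by linarith) hKpos.le
    _ = _ := by ring

/-! ### Integrability of the weights -/

lemma integrable_bracket_weight : Integrable (fun y : R2 => (1 + ‖y‖ ^ 2) ^ (-(3:ℝ) / 2)) :=
  integrable_rpow_neg_one_add_norm_sq (by simp; norm_num)

lemma integrable_singular_weight : Integrable (fun y : R2 => (‖y‖ * (1 + ‖y‖ ^ 2))⁻¹) := by
  have := (integrable_fun_norm_addHaar (volume : Measure R2) (f := fun r => (r * (1 + r ^ 2))⁻¹)).2
  apply this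
  have h1 : IntegrableOn (fun r : ℝ => (1 + r ^ 2)⁻¹) (Ioi 0) :=
    integrable_inv_one_add_sq.integrableOn
  refine h1.congr_fun (fun r hr => ?_) measurableSet_Ioi
  have : r ≠ 0 := (mem_Ioi.1 hr).ne'
  simp
  field_simp

lemma integrable_Kbar_weight {β : ℝ} {v : ℝ → ℝ}
    (hv : IsVBeta β v) : Integrable (fun y => Kbar v y * (‖y‖ ^ 2 / (1 + ‖y‖ ^ 2))) := by
  obtain ⟨Λ, h0, hΛ⟩ := Kbar_le hv
  refine (integrable_singular_weight.const_mul Λ).mono'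
    (((measurable_Kbar hv.1.continuous).mul (by fun_prop)).aestronglyMeasurable)
    (ae_of_all _ fun y => ?_)
  rcases eq_or_ne y 0 with rfl | hy
  · simp
  have hn : 0 < ‖y‖ := norm_pos_iff.2 hy
  rw [norm_eq_abs, abs_mul, abs_of_nonneg (by positivity : 0 ≤ ‖y‖ ^ 2 / (1 + ‖y‖ ^ 2))]
  calc _ ≤ Λ / ‖y‖ ^ 3 * (‖y‖ ^ 2 / (1 + ‖y‖ ^ 2)) := by gcongr; exact hΛ y
    _ = _ := by field_simp

/-! ### Translations of compactly supported functions -/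

lemma HasCompactSupport.comp_add_right {f : R2 → ℝ} (hf : HasCompactSupport f) (y : R2) :
    HasCompactSupport (fun x => f (x + y)) :=
  hf.comp_homeomorph (Homeomorph.addRight y)

lemma HasCompactSupport.sq_of {f : R2 → ℝ} (hf : HasCompactSupport f) :
    HasCompactSupport (fun x => f x ^ 2) := by
  simpa only [sq] using! hf.mul_left (f' := f)

lemma integrable_sq_sub_translate {η : R2 → ℝ} (hη : Continuous η) (hc : HasCompactSupport η)
    (y : R2) : Integrable (fun x => (η (x + y) - η x) ^ 2) := by
  refine Continuous.integrable_of_hasCompactSupport (by fun_prop) (HasCompactSupport.sq_of ?_)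
  simpa only [sub_eq_add_neg] using! (hc.comp_add_right y).add hc.neg

lemma integral_sq_sub_translate_le_four {η : R2 → ℝ} (hη : Continuous η)
    (hc : HasCompactSupport η) (y : R2) :
    ∫ x, (η (x + y) - η x) ^ 2 ≤ 4 * ∫ x, η x ^ 2 := by
  have hi : Integrable (fun x => η x ^ 2) :=
    Continuous.integrable_of_hasCompactSupport (by fun_prop) hc.sq_of
  have hi' : Integrable (fun x => η (x + y) ^ 2) := hi.comp_add_right y
  calc _ ≤ ∫ x, (2 * η (x + y) ^ 2 + 2 * η x ^ 2) := by
        refine integral_mono (integrable_sq_sub_translate hη hc y)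
          ((hi'.const_mul 2).add (hi.const_mul 2)) fun x => ?_
        simp only
        nlinarith [sq_nonneg (η (x + y) + η x)]
    _ = _ := by
        rw [integral_add (hi'.const_mul 2) (hi.const_mul 2), integral_const_mul,
          integral_const_mul, integral_add_right_eq_self (fun x => η x ^ 2)]
        ring

lemma integrable_norm_fderiv_sq {η : R2 → ℝ} (hη : ContDiff ℝ 1 η) (hc : HasCompactSupport η) :
    Integrable (fun x => ‖fderiv ℝ η x‖ ^ 2) := by
  refine Continuous.integrable_of_hasCompactSupport
    ((hη.continuous_fderiv one_ne_zero).norm.pow 2) (HasCompactSupport.sq_of ?_)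
  exact (hc.fderiv ℝ).norm

lemma integral_sq_sub_translate_le {η : R2 → ℝ} (hη : ContDiff ℝ 1 η) (hc : HasCompactSupport η)
    (y : R2) :
    ∫ x, (η (x + y) - η x) ^ 2 ≤ ‖y‖ ^ 2 * ∫ x, ‖fderiv ℝ η x‖ ^ 2 := by
  have hcd : Continuous (fderiv ℝ η) := hη.continuous_fderiv one_ne_zero
  have hG := integrable_norm_fderiv_sq hη hc
  have hpt : ∀ x, (η (x + y) - η x) ^ 2 ≤
      ∫ t in (0:ℝ)..1, ‖y‖ ^ 2 * ‖fderiv ℝ η (x + t • y)‖ ^ 2 := by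
    intro x
    have hcont : Continuous fun t : ℝ => fderiv ℝ η (x + t • y) y := by fun_prop
    have h1 : ∫ t in (0:ℝ)..1, fderiv ℝ η (x + t • y) y = η (x + y) - η x := by
      have : ∀ t : ℝ, HasDerivAt (fun t : ℝ => η (x + t • y)) (fderiv ℝ η (x + t • y) y) t := by
        intro t
        have h := (hη.differentiable one_ne_zero (x + t • y)).hasFDerivAt.comp_hasDerivAt t
          (((hasDerivAt_id t).smul_const y).const_add x)
        simpa using! h
      rw [intervalIntegral.integral_eq_sub_of_hasDerivAt (fun t _ => this t)
        (hcont.intervalIntegrable _ _)]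
      simp
    set c := η (x + y) - η x
    have h2 : 0 ≤ ∫ t in (0:ℝ)..1, (fderiv ℝ η (x + t • y) y - c) ^ 2 :=
      intervalIntegral.integral_nonneg zero_le_one fun t _ => sq_nonneg _
    have h3 : ∫ t in (0:ℝ)..1, (fderiv ℝ η (x + t • y) y - c) ^ 2 =
        (∫ t in (0:ℝ)..1, (fderiv ℝ η (x + t • y) y) ^ 2) - c ^ 2 := by
      have : ∀ t : ℝ, (fderiv ℝ η (x + t • y) y - c) ^ 2 =
          ((fderiv ℝ η (x + t • y) y) ^ 2 - 2 * c * fderiv ℝ η (x + t • y) y) + c ^ 2 := by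
        intro t; ring
      simp_rw [this]
      rw [intervalIntegral.integral_add (Continuous.intervalIntegrable (by fun_prop) _ _)
        (Continuous.intervalIntegrable (by fun_prop) _ _),
        intervalIntegral.integral_sub (Continuous.intervalIntegrable (by fun_prop) _ _)
        (Continuous.intervalIntegrable (by fun_prop) _ _), intervalIntegral.integral_const_mul,
        h1]
      simp
      ring
    calc c ^ 2 ≤ ∫ t in (0:ℝ)..1, (fderiv ℝ η (x + t • y) y) ^ 2 := by linarith
      _ ≤ _ := by
        refine intervalIntegral.integral_mono_on zero_le_one
          (Continuous.intervalIntegrable (by fun_prop) _ _)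
          (Continuous.intervalIntegrable (by fun_prop) _ _) fun t _ => ?_
        rw [← mul_pow, mul_comm, ← sq_abs]
        exact pow_le_pow_left₀ (abs_nonneg _) ((fderiv ℝ η (x + t • y)).le_opNorm y) 2
  have hint : Integrable (Function.uncurry fun (t : ℝ) (x : R2) =>
      ‖y‖ ^ 2 * ‖fderiv ℝ η (x + t • y)‖ ^ 2) ((volume.restrict (uIoc (0:ℝ) 1)).prod volume) := by
    refine (integrable_prod_iff ?_).2 ⟨ae_of_all _ fun t => ?_, ?_⟩
    · exact Continuous.aestronglyMeasurable (by unfold Function.uncurry; fun_prop)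
    · exact (hG.comp_add_right (t • y)).const_mul (‖y‖ ^ 2)
    · have : ∀ t : ℝ, ∫ x, ‖(Function.uncurry fun (t : ℝ) (x : R2) =>
          ‖y‖ ^ 2 * ‖fderiv ℝ η (x + t • y)‖ ^ 2) (t, x)‖ =
          ∫ x, ‖‖y‖ ^ 2 * ‖fderiv ℝ η x‖ ^ 2‖ := by
        intro t
        exact integral_add_right_eq_self (fun x => ‖‖y‖ ^ 2 * ‖fderiv ℝ η x‖ ^ 2‖) (t • y)
      simp_rw [this]
      simp
  have hswap := intervalIntegral_integral_swap hint
  have hI : Integrable fun x => ∫ t in (0:ℝ)..1, ‖y‖ ^ 2 * ‖fderiv ℝ η (x + t • y)‖ ^ 2 := by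
    have := hint.integral_prod_right
    simpa [intervalIntegral.integral_of_le, Function.uncurry] using! this
  calc _ ≤ ∫ x, ∫ t in (0:ℝ)..1, ‖y‖ ^ 2 * ‖fderiv ℝ η (x + t • y)‖ ^ 2 :=
        integral_mono (integrable_sq_sub_translate hη.continuous hc y) hI hpt
    _ = ∫ t in (0:ℝ)..1, ∫ x, ‖y‖ ^ 2 * ‖fderiv ℝ η (x + t • y)‖ ^ 2 := hswap.symm
    _ = ∫ t in (0:ℝ)..1, ‖y‖ ^ 2 * ∫ x, ‖fderiv ℝ η x‖ ^ 2 := by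
        congr 1
        ext t
        rw [integral_const_mul, integral_add_right_eq_self (fun x => ‖fderiv ℝ η x‖ ^ 2)]
    _ = _ := by simp

/-! ### Product integrals -/

lemma integrable_prod_of_weight {F : R2 × R2 → ℝ} {S : R2 → R2 → ℝ} {w : R2 → ℝ} {c : ℝ}
    (hF : AEStronglyMeasurable F (volume.prod volume)) (hw : Integrable w) (hw0 : ∀ y, 0 ≤ w y)
    (hS : ∀ y, Integrable fun x => S x y) (hSc : ∀ y, ∫ x, S x y ≤ c)
    (h : ∀ x y, |F (x, y)| ≤ w y * S x y) :
    Integrable F (volume.prod volume) ∧ |∫ p, F p ∂(volume.prod volume)| ≤ c * ∫ y, w y := by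
  have hsec : ∀ᵐ y, Integrable (fun x => F (x, y)) := by
    filter_upwards [hF.prodMk_right] with y hy
    exact ((hS y).const_mul (w y)).mono' hy (ae_of_all _ fun x => h x y)
  have hle : ∀ᵐ y, ∫ x, ‖F (x, y)‖ ≤ c * w y := by
    filter_upwards [hsec] with y hy
    calc _ ≤ ∫ x, w y * S x y := integral_mono hy.norm ((hS y).const_mul (w y)) fun x => h x y
      _ = w y * ∫ x, S x y := integral_const_mul _ _
      _ ≤ w y * c := mul_le_mul_of_nonneg_left (hSc y) (hw0 y)
      _ = _ := mul_comm _ _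
  have hnn : ∀ y, 0 ≤ ∫ x, ‖F (x, y)‖ := fun y => integral_nonneg fun x => norm_nonneg _
  have hint : Integrable F (volume.prod volume) := by
    refine (integrable_prod_iff' hF).2 ⟨hsec, (hw.const_mul c).mono' ?_ ?_⟩
    · exact hF.norm.prod_swap.integral_prod_right'
    · filter_upwards [hle] with y hy
      rwa [norm_eq_abs, abs_of_nonneg (hnn y)]
  refine ⟨hint, ?_⟩
  rw [← norm_eq_abs]
  calc _ ≤ ∫ p, ‖F p‖ ∂(volume.prod volume) := norm_integral_le_integral_norm _
    _ = ∫ y, ∫ x, ‖F (x, y)‖ := integral_prod_symm _ hint.norm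
    _ ≤ ∫ y, c * w y := integral_mono_ae hint.norm.integral_prod_right (hw.const_mul c) hle
    _ = _ := integral_const_mul _ _

/-! ### Cutoff functions of small Dirichlet energy -/

/-- The doubly logarithmic profile `log (1 + log (1 + |x|²))`, whose gradient is square integrable
in the plane. -/
def loglog (x : R2) : ℝ := log (1 + log (1 + ‖x‖ ^ 2))

lemma log_one_add_sq_nonneg (x : R2) : 0 ≤ log (1 + ‖x‖ ^ 2) :=
  log_nonneg (by nlinarith [sq_nonneg ‖x‖])

lemma contDiff_loglog : ContDiff ℝ 2 loglog := by
  have h1 : ContDiff ℝ 2 (fun x : R2 => log (1 + ‖x‖ ^ 2)) :=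
    (contDiff_const.add (contDiff_norm_sq ℝ)).log fun x => by positivity
  exact (contDiff_const.add h1).log fun x => by
    have := log_one_add_sq_nonneg x
    positivity

lemma norm_fderiv_loglog_sq_le (x : R2) :
    ‖fderiv ℝ loglog x‖ ^ 2 ≤ 4 * ((1 + ‖x‖ ^ 2)⁻¹ * ((1 + log (1 + ‖x‖ ^ 2)) ^ 2)⁻¹) := by
  have h0 := log_one_add_sq_nonneg x
  have h1 : HasFDerivAt (fun x : R2 => 1 + ‖x‖ ^ 2) (2 • innerSL ℝ x) x :=
    (hasStrictFDerivAt_norm_sq x).hasFDerivAt.const_add 1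
  have h2 := ((h1.log (by positivity)).const_add 1).log (by positivity)
  have h3 : fderiv ℝ loglog x = _ := h2.fderiv
  rw [h3, norm_smul, norm_smul, ← Nat.cast_smul_eq_nsmul ℝ, norm_smul, innerSL_apply_norm]
  simp only [norm_inv, norm_eq_abs]
  rw [abs_of_pos (by positivity), abs_of_pos (by positivity)]
  norm_num
  field_simp
  nlinarith [sq_nonneg ‖x‖]

lemma integrable_norm_fderiv_loglog_sq : Integrable (fun x => ‖fderiv ℝ loglog x‖ ^ 2) := by
  have hb : Integrable (fun x : R2 => (1 + ‖x‖ ^ 2)⁻¹ * ((1 + log (1 + ‖x‖ ^ 2)) ^ 2)⁻¹) := by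
    apply (integrable_fun_norm_addHaar (volume : Measure R2)
      (f := fun r => (1 + r ^ 2)⁻¹ * ((1 + log (1 + r ^ 2)) ^ 2)⁻¹)).2
    have hlog : ∀ r : ℝ, 0 ≤ log (1 + r ^ 2) := fun r => log_nonneg (by nlinarith [sq_nonneg r])
    have hd : ∀ r : ℝ, HasDerivAt (fun r : ℝ => -(1/2) * (1 + log (1 + r ^ 2))⁻¹)
        (r * ((1 + r ^ 2)⁻¹ * ((1 + log (1 + r ^ 2)) ^ 2)⁻¹)) r := by
      intro r
      have hl := hlog r
      have h1 : HasDerivAt (fun r : ℝ => 1 + r ^ 2) (2 * r) r := by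
        simpa using (hasDerivAt_pow 2 r).const_add 1
      have h2 := ((((h1.log (by positivity)).const_add 1).inv (by positivity)).const_mul
        (-(1/2) : ℝ))
      refine h2.congr_deriv ?_
      field_simp
    have := integrableOn_Ioi_deriv_of_nonneg (a := 0) (l := -(1/2) * 0)
      (hd 0).continuousAt.continuousWithinAt (fun r _ => hd r)
      (fun r hr => by
        have := hlog r
        have : 0 < r := hr
        positivity) ?_
    · refine this.congr_fun (fun r _ => ?_) measurableSet_Ioi
      simp
    · refine (tendsto_inv_atTop_zero.comp (tendsto_atTop_add_const_left _ _
        (tendsto_log_atTop.comp (tendsto_atTop_add_const_left _ _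
          (tendsto_pow_atTop two_ne_zero))))).const_mul _
  refine (hb.const_mul 4).mono' ?_ (ae_of_all _ fun x => ?_)
  · exact ((contDiff_loglog.continuous_fderiv two_ne_zero).norm.pow 2).aestronglyMeasurable
  · rw [norm_of_nonneg (by positivity)]
    exact norm_fderiv_loglog_sq_le x

lemma loglog_nonneg (x : R2) : 0 ≤ loglog x :=
  log_nonneg (by linarith [log_one_add_sq_nonneg x])

lemma exists_cutoff (ρ : ℝ) {ε : ℝ} (hε : 0 < ε) :
    ∃ η : R2 → ℝ, ContDiff ℝ 2 η ∧ HasCompactSupport η ∧ (∀ x, 0 ≤ η x) ∧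
      (∀ x, ‖x‖ ≤ ρ → η x = 1) ∧ ∫ x, ‖fderiv ℝ η x‖ ^ 2 ≤ ε := by
  let g : ContDiffBump (0:ℝ) := ⟨1, 2, one_pos, one_lt_two⟩
  have hg : ContDiff ℝ 2 g := g.contDiff
  obtain ⟨S, hS⟩ := (hg.continuous_deriv (by norm_num)).bounded_above_of_compact_support
    g.hasCompactSupport.deriv
  set E := ∫ x, ‖fderiv ℝ loglog x‖ ^ 2 with hE
  have hlim : Tendsto (fun n : ℝ => S ^ 2 * E * (n⁻¹) ^ 2) atTop (𝓝 0) := by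
    simpa using (tendsto_inv_atTop_zero.pow 2).const_mul (S ^ 2 * E)
  obtain ⟨n, hn, hn1, hnρ⟩ := ((hlim.eventually (gt_mem_nhds hε)).and
    ((eventually_ge_atTop 1).and (eventually_ge_atTop (log (1 + log (1 + ρ ^ 2)))))).exists
  have hn0 : 0 < n := by linarith
  have hd : ∀ x, ‖fderiv ℝ (fun x => g (n⁻¹ * loglog x)) x‖ ≤ S * (n⁻¹ * ‖fderiv ℝ loglog x‖) := by
    intro x
    have h1 := ((contDiff_loglog.differentiable two_ne_zero x).hasFDerivAt.const_mul n⁻¹)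
    have h2 := ((hg.differentiable two_ne_zero _).hasDerivAt).comp_hasFDerivAt x h1
    have h3 : fderiv ℝ (fun x => g (n⁻¹ * loglog x)) x = _ := h2.fderiv
    rw [h3, norm_smul, norm_smul, norm_of_nonneg (by positivity : 0 ≤ n⁻¹)]
    gcongr
    exact hS _
  have hcd : ContDiff ℝ 2 (fun x => g (n⁻¹ * loglog x)) :=
    hg.comp (contDiff_const.mul contDiff_loglog)
  have hcs : HasCompactSupport (fun x => g (n⁻¹ * loglog x)) := by
    refine HasCompactSupport.of_support_subset_isCompact
      (isCompact_closedBall (0:R2) (exp (exp (2 * n)))) fun x hx => ?_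
    have hx' : n⁻¹ * loglog x ∈ Function.support g := hx
    rw [g.support_eq, mem_ball_zero_iff, norm_eq_abs,
      abs_of_nonneg (mul_nonneg (by positivity) (loglog_nonneg x)),
      inv_mul_lt_iff₀ hn0] at hx'
    have hl := log_one_add_sq_nonneg x
    have h2 : loglog x < 2 * n := by rwa [show g.rOut = 2 from rfl, mul_comm] at hx'
    have h3 : 1 + log (1 + ‖x‖ ^ 2) < exp (2 * n) := (log_lt_iff_lt_exp (by positivity)).1 h2
    have h4 : 1 + ‖x‖ ^ 2 < exp (exp (2 * n)) :=
      (log_lt_iff_lt_exp (by positivity)).1 (by linarith)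
    rw [mem_closedBall_zero_iff]
    nlinarith [sq_nonneg (‖x‖ - 1)]
  refine ⟨fun x => g (n⁻¹ * loglog x), hcd, hcs, fun x => g.nonneg, fun x hx => ?_, ?_⟩
  · apply g.one_of_mem_closedBall
    rw [mem_closedBall_zero_iff, norm_of_nonneg (mul_nonneg (by positivity) (loglog_nonneg x)),
      inv_mul_le_iff₀ hn0]
    have hl := log_one_add_sq_nonneg x
    have : loglog x ≤ log (1 + log (1 + ρ ^ 2)) := by
      unfold loglog
      gcongr
    calc _ ≤ n := this.trans hnρ
      _ = _ := (mul_one n).symm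
  · calc _ ≤ ∫ x, S ^ 2 * (n⁻¹) ^ 2 * ‖fderiv ℝ loglog x‖ ^ 2 := by
          refine integral_mono (integrable_norm_fderiv_sq (hcd.of_le one_le_two) hcs)
            (integrable_norm_fderiv_loglog_sq.const_mul _) fun x => ?_
          calc _ ≤ (S * (n⁻¹ * ‖fderiv ℝ loglog x‖)) ^ 2 :=
                pow_le_pow_left₀ (norm_nonneg _) (hd x) 2
            _ = _ := by ring
      _ = S ^ 2 * E * (n⁻¹) ^ 2 := by rw [integral_const_mul]; ring
      _ ≤ ε := hn.le

/-! ### The quadratic form of a bounded derivative -/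

lemma integral_mul_deriv_eq_neg_of_bounded {d : R2} {f f' g g' : R2 → ℝ} {C : ℝ}
    (hf : Continuous f) (hf' : Continuous f') (hfC : ∀ y, |f y| ≤ C) (hfC' : ∀ y, |f' y| ≤ C)
    (hg : Integrable g) (hg' : Integrable g')
    (hfd : ∀ y, HasLineDerivAt ℝ f (f' y) y d) (hgd : ∀ y, HasLineDerivAt ℝ g (g' y) y d) :
    ∫ y, f' y * g y = -∫ y, f y * g' y := by
  have h := integral_bilinear_hasLineDerivAt_right_eq_neg_left_of_integrable
    (μ := (volume : Measure R2)) (B := ContinuousLinearMap.mul ℝ ℝ) (f := f) (f' := f')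
    (g := g) (g' := g') (v := d)
    (hg.bdd_mul hf'.aestronglyMeasurable (ae_of_all _ hfC'))
    (hg'.bdd_mul hf.aestronglyMeasurable (ae_of_all _ hfC))
    (hg.bdd_mul hf.aestronglyMeasurable (ae_of_all _ hfC))
    (fun x _ => hfd x) (fun x _ => hgd x)
  simp only [ContinuousLinearMap.mul_apply'] at h
  linarith

lemma integrable_prod_of_weight_shift {F : R2 × R2 → ℝ} {S : R2 → R2 → ℝ} {w : R2 → ℝ} {c : ℝ}
    (hF : Continuous F) (hw : Integrable w) (hw0 : ∀ y, 0 ≤ w y)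
    (hS : ∀ y, Integrable fun x => S x y) (hSc : ∀ y, ∫ x, S x y ≤ c)
    (h : ∀ x y, |F (x, y)| ≤ w y * S x y) :
    Integrable (fun p : R2 × R2 => F (p.1 - p.2, p.2)) (volume.prod volume) := by
  refine (integrable_prod_of_weight (S := fun x y => S (x - y) y) (c := c)
    (Continuous.aestronglyMeasurable (by fun_prop)) hw hw0 (fun y => (hS y).comp_sub_right y)
    (fun y => ?_) (fun x y => h (x - y) y)).1
  rw [integral_sub_right_eq_self (fun x => S x y)]
  exact hSc y

lemma abs_symbol_combination_le {A w r a b q k0 k1 k2 : ℝ} (hA : 0 ≤ A) (hw : 0 ≤ w) (hr : 1 ≤ r)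
    (h0 : |k0| ≤ A * w) (h1 : |k1| ≤ A * w / r) (h2 : |k2| ≤ A * w / r ^ 2) :
    |2 * a * b * k0 + 2 * q * a * k1 + 2 * q * b * k1 + q ^ 2 * k2| ≤
      A * w * (2 * a ^ 2 + 2 * b ^ 2 + 3 * (q ^ 2 / r ^ 2)) := by
  have hr0 : 0 < r := by linarith
  have hAw : 0 ≤ A * w := by positivity
  set t := |q| / r with ht
  have htq : t ^ 2 = q ^ 2 / r ^ 2 := by rw [ht, div_pow, sq_abs]
  have e0 : |2 * a * b * k0| ≤ 2 * |a| * |b| * (A * w) := by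
    rw [abs_mul, abs_mul, abs_mul, abs_two]; gcongr
  have e1 : |2 * q * a * k1| ≤ 2 * t * |a| * (A * w) := by
    calc _ = 2 * |q| * |a| * |k1| := by rw [abs_mul, abs_mul, abs_mul, abs_two]
      _ ≤ 2 * |q| * |a| * (A * w / r) := by gcongr
      _ = _ := by rw [ht]; ring
  have e2 : |2 * q * b * k1| ≤ 2 * t * |b| * (A * w) := by
    calc _ = 2 * |q| * |b| * |k1| := by rw [abs_mul, abs_mul, abs_mul, abs_two]
      _ ≤ 2 * |q| * |b| * (A * w / r) := by gcongr
      _ = _ := by rw [ht]; ring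
  have e3 : |q ^ 2 * k2| ≤ t ^ 2 * (A * w) := by
    calc _ = q ^ 2 * |k2| := by rw [abs_mul, abs_sq]
      _ ≤ q ^ 2 * (A * w / r ^ 2) := by gcongr
      _ = _ := by rw [htq]; ring
  calc _ ≤ |2 * a * b * k0| + |2 * q * a * k1| + |2 * q * b * k1| + |q ^ 2 * k2| :=
        (abs_add_le _ _).trans (add_le_add ((abs_add_le _ _).trans
          (add_le_add (abs_add_le _ _) le_rfl)) le_rfl)
    _ ≤ A * w * (2 * |a| * |b| + 2 * t * |a| + 2 * t * |b| + t ^ 2) := by linarith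
    _ ≤ A * w * (2 * |a| ^ 2 + 2 * |b| ^ 2 + 3 * t ^ 2) := by
        gcongr ?_ * ?_
        nlinarith [sq_nonneg (|a| - |b|), sq_nonneg (t - |a|), sq_nonneg (t - |b|)]
    _ = _ := by rw [sq_abs, sq_abs, htq]

lemma abs_symbol_combination_le' {A w r b q k0 k1 : ℝ} (hA : 0 ≤ A) (hw : 0 ≤ w) (hr : 1 ≤ r)
    (h0 : |k0| ≤ A * w) (h1 : |k1| ≤ A * w / r) :
    |2 * q * b * k0 + q ^ 2 * k1| ≤ A * w * (b ^ 2 + 2 * q ^ 2) := by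
  have hAw : 0 ≤ A * w := by positivity
  have h1' : |k1| ≤ A * w := h1.trans (div_le_self hAw hr)
  have e0 : |2 * q * b * k0| ≤ 2 * |q| * |b| * (A * w) := by
    rw [abs_mul, abs_mul, abs_mul, abs_two]; gcongr
  have e1 : |q ^ 2 * k1| ≤ q ^ 2 * (A * w) := by
    rw [abs_mul, abs_sq]; gcongr
  calc _ ≤ A * w * (2 * |q| * |b| + q ^ 2) := by linarith [abs_add_le (2 * q * b * k0) (q ^ 2 * k1)]
    _ ≤ _ := by
        gcongr ?_ * ?_
        nlinarith [sq_nonneg (|q| - |b|), sq_abs q, sq_abs b]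

lemma IsSymbol.exists_common_bound {d : R2} {f f1 f2 : R2 → ℝ} (hf : IsSymbol d (-3) f f1 f2) :
    ∃ A, 0 ≤ A ∧ ∀ y, |f y| ≤ A * (1 + ‖y‖ ^ 2) ^ (-(3:ℝ) / 2) ∧
      |f1 y| ≤ A * (1 + ‖y‖ ^ 2) ^ (-(3:ℝ) / 2) / √(1 + ‖y‖ ^ 2) ∧
      |f2 y| ≤ A * (1 + ‖y‖ ^ 2) ^ (-(3:ℝ) / 2) / √(1 + ‖y‖ ^ 2) ^ 2 := by
  obtain ⟨A, hA, h0⟩ := hf.bound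
  obtain ⟨B, hB, h1⟩ := hf.bound1
  obtain ⟨D, hD, h2⟩ := hf.bound2
  refine ⟨A + B + D, by positivity, fun y => ?_⟩
  have hs : 0 < 1 + ‖y‖ ^ 2 := by positivity
  refine ⟨(h0 y).trans ?_, (h1 y).trans ?_, (h2 y).trans ?_⟩
  · gcongr; linarith
  · rw [mul_div_assoc, sqrt_eq_rpow, ← rpow_sub hs,
      show (-3 - 1 : ℝ) / 2 = -3 / 2 - 1 / 2 by norm_num]
    gcongr; linarith
  · rw [mul_div_assoc, sq_sqrt hs.le, ← rpow_sub_one hs.ne',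
      show (-3 - 2 : ℝ) / 2 = -3 / 2 - 1 by norm_num]
    gcongr; linarith

lemma hasLineDerivAt_comp_const_add {f : R2 → ℝ} {x y d : R2} {f' : ℝ}
    (h : HasLineDerivAt ℝ f f' (x + y) d) : HasLineDerivAt ℝ (fun y => f (x + y)) f' y d := by
  simpa only [HasLineDerivAt, add_assoc] using! h

lemma hasLineDerivAt_comp_const_sub {f : R2 → ℝ} {x y d : R2}
    (h : DifferentiableAt ℝ f (x - y)) :
    HasLineDerivAt ℝ (fun y => f (x - y)) (-(fderiv ℝ f (x - y) d)) y d := by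
  have := (h.hasFDerivAt.comp y ((hasFDerivAt_id y).const_sub x)).hasLineDerivAt d
  simpa using! this

/-- Two integrations by parts show that the quadratic form of a derivative `∂_d u` against a
symbol of order `-3` is controlled by the Dirichlet energy of the cutoff, if `u` is bounded. -/
lemma exists_bound_symbol_form {u : R2 → ℝ} (hu : ContDiff ℝ 1 u) {M : ℝ}
    (hM : ∀ x, |u x| ≤ M) (hM' : ∀ x, ‖fderiv ℝ u x‖ ≤ M) {d : R2} {K K1 K2 : R2 → ℝ}
    (hK : IsSymbol d (-3) K K1 K2) :
    ∃ C, 0 ≤ C ∧ ∀ η : R2 → ℝ, ContDiff ℝ 1 η → HasCompactSupport η →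
      Integrable (fun p : R2 × R2 => fderiv ℝ u p.1 d * fderiv ℝ u (p.1 + p.2) d *
        ((η (p.1 + p.2) - η p.1) ^ 2 * K p.2)) (volume.prod volume) ∧
      |∫ p : R2 × R2, fderiv ℝ u p.1 d * fderiv ℝ u (p.1 + p.2) d *
        ((η (p.1 + p.2) - η p.1) ^ 2 * K p.2) ∂(volume.prod volume)| ≤
      C * ∫ x, ‖fderiv ℝ η x‖ ^ 2 := by
  obtain ⟨A, hA, hb⟩ := hK.exists_common_bound
  set w : R2 → ℝ := fun y => (1 + ‖y‖ ^ 2) ^ (-(3:ℝ) / 2) with hwdef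
  have hw0 : ∀ y, 0 ≤ w y := fun y => by positivity
  have hw : Integrable w := integrable_bracket_weight
  have hAw0 : ∀ y, 0 ≤ A * w y := fun y => mul_nonneg hA (hw0 y)
  have hAw : Integrable (fun y => A * w y) := hw.const_mul A
  have hM0 : 0 ≤ M := (abs_nonneg _).trans (hM 0)
  refine ⟨M ^ 2 * ((4 * ‖d‖ ^ 2 + 3) * ∫ y, A * w y), mul_nonneg (by positivity)
    (mul_nonneg (by positivity) (integral_nonneg hAw0)), fun η hη hc => ?_⟩
  set E := ∫ x, ‖fderiv ℝ η x‖ ^ 2 with hE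
  have hηc := hη.continuous
  have hdη := hη.continuous_fderiv one_ne_zero
  have hdu := hu.continuous_fderiv one_ne_zero
  have huc := hu.continuous
  have hKc := hK.cont
  have hK1c := hK.cont1
  have hK2c := hK.cont2
  have hr : ∀ y : R2, 1 ≤ √(1 + ‖y‖ ^ 2) := fun y => one_le_sqrt.2 (by nlinarith [sq_nonneg ‖y‖])
  -- the three kernels
  set P1 : R2 × R2 → ℝ := fun p => (η (p.1 + p.2) - η p.1) ^ 2 * K p.2 with hP1
  set P2 : R2 × R2 → ℝ := fun p => 2 * (η (p.1 + p.2) - η p.1) * fderiv ℝ η (p.1 + p.2) d * K p.2 +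
    (η (p.1 + p.2) - η p.1) ^ 2 * K1 p.2 with hP2
  set P3 : R2 × R2 → ℝ := fun p =>
    2 * fderiv ℝ η p.1 d * fderiv ℝ η (p.1 - p.2) d * K p.2 +
    2 * (η p.1 - η (p.1 - p.2)) * fderiv ℝ η p.1 d * K1 p.2 +
    2 * (η p.1 - η (p.1 - p.2)) * fderiv ℝ η (p.1 - p.2) d * K1 p.2 +
    (η p.1 - η (p.1 - p.2)) ^ 2 * K2 p.2 with hP3
  have hP1c : Continuous P1 := by fun_prop
  have hP2c : Continuous P2 := by fun_prop
  have hP3c : Continuous P3 := by fun_prop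
  -- integrals in the first variable
  have iq := integrable_sq_sub_translate hηc hc
  have iq4 := integral_sq_sub_translate_le_four hηc hc
  have iqE := integral_sq_sub_translate_le hη hc
  have iθ : Integrable (fun x => (fderiv ℝ η x d) ^ 2) := by
    refine Continuous.integrable_of_hasCompactSupport (by fun_prop) (HasCompactSupport.sq_of ?_)
    exact hc.fderiv_apply ℝ d
  have iθE : ∫ x, (fderiv ℝ η x d) ^ 2 ≤ ‖d‖ ^ 2 * E := by
    rw [hE, ← integral_const_mul]
    refine integral_mono iθ ((integrable_norm_fderiv_sq hη hc).const_mul _) fun x => ?_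
    simp only
    rw [← sq_abs, ← mul_pow, mul_comm]
    exact pow_le_pow_left₀ (abs_nonneg _) ((fderiv ℝ η x).le_opNorm d) 2
  have I1 : Integrable P1 (volume.prod volume) := by
    refine (integrable_prod_of_weight (S := fun x y => (η (x + y) - η x) ^ 2)
      hP1c.aestronglyMeasurable hAw hAw0 iq iq4 fun x y => ?_).1
    simp only [hP1]
    rw [abs_mul, abs_sq, mul_comm]
    exact mul_le_mul_of_nonneg_right (hb y).1 (sq_nonneg _)
  have hS2 : ∀ y, Integrable fun x => (fderiv ℝ η (x + y) d) ^ 2 + 2 * (η (x + y) - η x) ^ 2 :=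
    fun y => (iθ.comp_add_right y).add ((iq y).const_mul 2)
  have hS2c : ∀ y, ∫ x, ((fderiv ℝ η (x + y) d) ^ 2 + 2 * (η (x + y) - η x) ^ 2) ≤
      (∫ x, (fderiv ℝ η x d) ^ 2) + 2 * (4 * ∫ x, η x ^ 2) := fun y => by
    rw [integral_add (iθ.comp_add_right y) ((iq y).const_mul 2), integral_const_mul,
      integral_add_right_eq_self (fun x => (fderiv ℝ η x d) ^ 2)]
    linarith [iq4 y]
  have hP2b : ∀ x y, |P2 (x, y)| ≤ A * w y *
      ((fderiv ℝ η (x + y) d) ^ 2 + 2 * (η (x + y) - η x) ^ 2) := fun x y =>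
    abs_symbol_combination_le' hA (hw0 y) (hr y) (hb y).1 (hb y).2.1
  have I2 : Integrable P2 (volume.prod volume) :=
    (integrable_prod_of_weight hP2c.aestronglyMeasurable hAw hAw0 hS2 hS2c hP2b).1
  have I2' : Integrable (fun p : R2 × R2 => P2 (p.1 - p.2, p.2)) (volume.prod volume) :=
    integrable_prod_of_weight_shift hP2c hAw hAw0 hS2 hS2c hP2b
  have iq' : ∀ y, Integrable (fun x => (η x - η (x - y)) ^ 2) := fun y => by
    have := (iq y).comp_sub_right y
    simpa using! this
  have iqE' : ∀ y, ∫ x, (η x - η (x - y)) ^ 2 ≤ ‖y‖ ^ 2 * E := fun y => by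
    have h := integral_sub_right_eq_self (μ := volume) (fun x => (η (x + y) - η x) ^ 2) y
    simp only [sub_add_cancel] at h
    rw [h]
    exact iqE y
  have hE0 : 0 ≤ E := integral_nonneg fun x => sq_nonneg _
  have I3 : ∀ (c : ℝ) (F : R2 × R2 → ℝ), 0 ≤ c → Continuous F → (∀ p, |F p| ≤ c) →
      Integrable (fun p => F p * P3 p) (volume.prod volume) ∧
      |∫ p, F p * P3 p ∂(volume.prod volume)| ≤
        c * ((4 * ‖d‖ ^ 2 + 3) * E) * ∫ y, A * w y := by
    intro c F hc0 hF hFM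
    have hS : ∀ y : R2, Integrable fun x => c * (2 * (fderiv ℝ η x d) ^ 2 +
        2 * (fderiv ℝ η (x - y) d) ^ 2 +
        3 * ((η x - η (x - y)) ^ 2 / √(1 + ‖y‖ ^ 2) ^ 2)) := fun y =>
      (((iθ.const_mul 2).add ((iθ.comp_sub_right y).const_mul 2)).add
        (((iq' y).div_const _).const_mul 3)).const_mul _
    refine integrable_prod_of_weight (hF.mul hP3c).aestronglyMeasurable hAw hAw0 hS
      (fun y => ?_) fun x y => ?_
    · have ia : Integrable fun x => 2 * (fderiv ℝ η x d) ^ 2 := iθ.const_mul 2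
      have ib : Integrable fun x => 2 * (fderiv ℝ η (x - y) d) ^ 2 :=
        (iθ.comp_sub_right y).const_mul 2
      have ic : Integrable fun x => 2 * (fderiv ℝ η x d) ^ 2 + 2 * (fderiv ℝ η (x - y) d) ^ 2 :=
        ia.add ib
      rw [integral_const_mul, integral_add ic (((iq' y).div_const _).const_mul 3),
        integral_add ia ib, integral_const_mul, integral_const_mul, integral_const_mul,
        integral_div, integral_sub_right_eq_self (fun x => (fderiv ℝ η x d) ^ 2)]
      have : (∫ x, (η x - η (x - y)) ^ 2) / √(1 + ‖y‖ ^ 2) ^ 2 ≤ E := by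
        rw [sq_sqrt (by positivity), div_le_iff₀ (by positivity)]
        nlinarith [iqE' y]
      gcongr
      linarith
    · simp only [abs_mul]
      calc _ ≤ c * (A * w y * (2 * (fderiv ℝ η x d) ^ 2 +
            2 * (fderiv ℝ η (x - y) d) ^ 2 +
            3 * ((η x - η (x - y)) ^ 2 / √(1 + ‖y‖ ^ 2) ^ 2))) :=
          mul_le_mul (hFM _) (abs_symbol_combination_le hA (hw0 y) (hr y) (hb y).1 (hb y).2.1
            (hb y).2.2) (abs_nonneg _) hc0
        _ = _ := by ring
  set ξ : R2 → ℝ := fun x => fderiv ℝ u x d with hξ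
  have hξc : Continuous ξ := by fun_prop
  set B := max M (M * ‖d‖) with hB
  have hξB : ∀ x, |ξ x| ≤ B := fun x =>
    (((fderiv ℝ u x).le_opNorm d).trans (by gcongr; exact hM' x)).trans (le_max_right _ _)
  have huB : ∀ x, |u x| ≤ B := fun x => (hM x).trans (le_max_left _ _)
  have hB0 : 0 ≤ B := (abs_nonneg _).trans (huB 0)
  have hbd : ∀ a b : ℝ, |a| ≤ B → |b| ≤ B → ‖a * b‖ ≤ B ^ 2 := fun a b ha hb => by
    rw [norm_mul, sq]; exact mul_le_mul ha hb (abs_nonneg _) hB0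
  set F1 : R2 × R2 → ℝ := fun p => ξ p.1 * ξ (p.1 + p.2) * P1 p with hF1
  set F2 : R2 × R2 → ℝ := fun p => ξ p.1 * u (p.1 + p.2) * P2 p with hF2
  set F3 : R2 × R2 → ℝ := fun p => ξ (p.1 - p.2) * u p.1 * P2 (p.1 - p.2, p.2) with hF3
  set F4 : R2 × R2 → ℝ := fun p => u p.1 * u (p.1 - p.2) * P3 p with hF4
  have iF1 : Integrable F1 (volume.prod volume) := I1.bdd_mul (c := B ^ 2)
    (Continuous.aestronglyMeasurable (by fun_prop))
    (ae_of_all _ fun p => hbd _ _ (hξB _) (hξB _))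
  have iF2 : Integrable F2 (volume.prod volume) := I2.bdd_mul (c := B ^ 2)
    (Continuous.aestronglyMeasurable (by fun_prop))
    (ae_of_all _ fun p => hbd _ _ (hξB _) (huB _))
  have iF3 : Integrable F3 (volume.prod volume) := I2'.bdd_mul (c := B ^ 2)
    (Continuous.aestronglyMeasurable (by fun_prop))
    (ae_of_all _ fun p => hbd _ _ (hξB _) (huB _))
  obtain ⟨iF4, hF4le⟩ := I3 (M ^ 2) (fun p => u p.1 * u (p.1 - p.2)) (by positivity)
    (by fun_prop) fun p => by
    rw [abs_mul, sq]; exact mul_le_mul (hM _) (hM _) (abs_nonneg _) hM0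
  have hθd : ∀ x, HasLineDerivAt ℝ η (fderiv ℝ η x d) x d := fun x =>
    (hη.differentiable one_ne_zero x).hasFDerivAt.hasLineDerivAt d
  have hud : ∀ x, HasLineDerivAt ℝ u (ξ x) x d := fun x =>
    (hu.differentiable one_ne_zero x).hasFDerivAt.hasLineDerivAt d
  have e12 : ∫ p, F1 p ∂(volume.prod volume) = -∫ p, F2 p ∂(volume.prod volume) := by
    rw [integral_prod _ iF1, integral_prod _ iF2, ← integral_neg]
    refine integral_congr_ae ?_
    filter_upwards [I1.prod_right_ae, I2.prod_right_ae] with x h1 h2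
    have := integral_mul_deriv_eq_neg_of_bounded (d := d) (C := B)
      (f := fun y => u (x + y)) (f' := fun y => ξ (x + y)) (g := fun y => P1 (x, y))
      (g' := fun y => P2 (x, y)) (by fun_prop) (by fun_prop) (fun y => huB _) (fun y => hξB _)
      h1 h2 (fun y => hasLineDerivAt_comp_const_add (hud _)) (fun y => ?_)
    · simp only [hF1, hF2, mul_assoc, integral_const_mul] at this ⊢
      rw [this]; ring
    · have hq : HasLineDerivAt ℝ (fun y => η (x + y) - η x) (fderiv ℝ η (x + y) d) y d :=
        HasDerivAt.sub_const _ (hasLineDerivAt_comp_const_add (hθd (x + y)))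
      have := HasDerivAt.mul (HasDerivAt.pow hq 2) (hK.deriv1 y)
      simpa [HasLineDerivAt, hP1, hP2] using! this
  have e23 : ∫ p, F2 p ∂(volume.prod volume) = ∫ p, F3 p ∂(volume.prod volume) := by
    rw [integral_prod_symm _ iF2, integral_prod_symm _ iF3]
    congr 1
    ext y
    rw [← integral_sub_right_eq_self (fun x => F2 (x, y)) y]
    simp only [hF2, hF3, sub_add_cancel]
  have e34 : ∫ p, F3 p ∂(volume.prod volume) = ∫ p, F4 p ∂(volume.prod volume) := by
    rw [integral_prod _ iF3, integral_prod _ iF4]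
    refine integral_congr_ae ?_
    have I3' : Integrable P3 (volume.prod volume) := by
      simpa using (I3 1 (fun _ => 1) zero_le_one (by fun_prop) (fun _ => by simp)).1
    filter_upwards [I2'.prod_right_ae, I3'.prod_right_ae] with x h2 h3
    have := integral_mul_deriv_eq_neg_of_bounded (d := d) (C := B)
      (f := fun y => u (x - y)) (f' := fun y => -ξ (x - y)) (g := fun y => P2 (x - y, y))
      (g' := fun y => P3 (x, y)) (by fun_prop) (by fun_prop) (fun y => huB _)
      (fun y => by rw [abs_neg]; exact hξB _) h2 h3
      (fun y => hasLineDerivAt_comp_const_sub (hu.differentiable one_ne_zero _)) (fun y => ?_)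
    · simp only [neg_mul, integral_neg, neg_inj] at this
      simp only [hF3, mul_assoc, mul_left_comm _ (u x), integral_const_mul, this]
    · have hq : HasLineDerivAt ℝ (fun y => η x - η (x - y)) (fderiv ℝ η (x - y) d) y d := by
        have := HasDerivAt.const_sub (η x)
          (hasLineDerivAt_comp_const_sub (d := d) (hη.differentiable one_ne_zero (x - y)))
        rwa [neg_neg] at this
      have := (((HasDerivAt.const_mul 2 hq).mul_const (fderiv ℝ η x d)).mul (hK.deriv1 y)).add
        (HasDerivAt.mul (HasDerivAt.pow hq 2) (hK.deriv2 y))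
      simp only [hP2, hP3, sub_add_cancel]
      refine (HasDerivAt.congr_deriv this ?_)
      simp
      ring
  refine ⟨iF1, ?_⟩
  rw [e12, e23, e34, abs_neg]
  calc _ ≤ _ := hF4le
    _ = _ := by ring

lemma exists_bound_Kbar_form {β : ℝ} (hβ1 : 2/3 < β) (hβ2 : β < 3/2) {v : ℝ → ℝ}
    (hv : IsVBeta β v) {u : R2 → ℝ} (hu : ContDiff ℝ 1 u) {M : ℝ}
    (hM : ∀ x, |u x| ≤ M) (hM' : ∀ x, ‖fderiv ℝ u x‖ ≤ M) (d : R2) :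
    ∃ C, 0 ≤ C ∧ ∀ η : R2 → ℝ, ContDiff ℝ 1 η → HasCompactSupport η →
      ∫ p : R2 × R2, fderiv ℝ u p.1 d * fderiv ℝ u (p.1 + p.2) d *
        ((η (p.1 + p.2) - η p.1) ^ 2 * Kbar v p.2) ∂(volume.prod volume) ≤
      C * ∫ x, ‖fderiv ℝ η x‖ ^ 2 := by
  obtain ⟨K1, K2, hK⟩ := exists_isSymbol_smoothKbar hβ1 d
  obtain ⟨C, hC, hbound⟩ := exists_bound_symbol_form hu hM hM' hK
  have hKm := measurable_Kbar hv.1.continuous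
  have hKi := integrable_Kbar_weight hv
  have hdu := hu.continuous_fderiv one_ne_zero
  have hM0 : 0 ≤ M := (abs_nonneg _).trans (hM 0)
  set w : R2 → ℝ := fun y => (M * ‖d‖) ^ 2 * (6 * (Kbar v y * (‖y‖ ^ 2 / (1 + ‖y‖ ^ 2)))) with hw
  have hwi : Integrable w := (hKi.const_mul 6).const_mul _
  have hw0 : ∀ y, 0 ≤ w y := fun y => by
    have := Kbar_nonneg hβ1 hβ2 hv y
    positivity
  refine ⟨C + ∫ y, w y, add_nonneg hC (integral_nonneg hw0), fun η hη hc => ?_⟩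
  have hηc := hη.continuous
  set E := ∫ x, ‖fderiv ℝ η x‖ ^ 2
  have hE0 : 0 ≤ E := integral_nonneg fun x => sq_nonneg _
  have hξξ : ∀ x z, |fderiv ℝ u x d * fderiv ℝ u z d| ≤ (M * ‖d‖) ^ 2 := fun x z => by
    have h : ∀ x, |fderiv ℝ u x d| ≤ M * ‖d‖ := fun x =>
      ((fderiv ℝ u x).le_opNorm d).trans (by gcongr; exact hM' x)
    rw [abs_mul, sq]
    exact mul_le_mul (h x) (h z) (abs_nonneg _) (by positivity)
  set D : R2 × R2 → ℝ := fun p => fderiv ℝ u p.1 d * fderiv ℝ u (p.1 + p.2) d *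
        ((η (p.1 + p.2) - η p.1) ^ 2 * (Kbar v p.2 - smoothKbar β p.2)) with hD
  have hmeas : Continuous fun p : R2 × R2 => fderiv ℝ u p.1 d * fderiv ℝ u (p.1 + p.2) d *
        (η (p.1 + p.2) - η p.1) ^ 2 := by fun_prop
  obtain ⟨iD, hDle⟩ := integrable_prod_of_weight (F := D)
    (S := fun x y => (η (x + y) - η x) ^ 2 / ‖y‖ ^ 2) (c := E) (by
      have h1 : Measurable fun p : R2 × R2 => fderiv ℝ u p.1 d * fderiv ℝ u (p.1 + p.2) d *
        (η (p.1 + p.2) - η p.1) ^ 2 * (Kbar v p.2 - smoothKbar β p.2) :=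
        hmeas.measurable.mul ((hKm.sub hK.cont.measurable).comp measurable_snd)
      simpa only [hD, mul_assoc] using h1.aestronglyMeasurable) hwi hw0
    (fun y => (integrable_sq_sub_translate hηc hc y).div_const _) (fun y => by
      rw [integral_div]
      rcases eq_or_ne y 0 with rfl | hy
      · simpa using hE0
      have : 0 < ‖y‖ := norm_pos_iff.2 hy
      rw [div_le_iff₀ (by positivity), mul_comm]
      exact integral_sq_sub_translate_le hη hc y) (fun x y => by
      rcases eq_or_ne y 0 with rfl | hy
      · simp [hD]
      have : 0 < ‖y‖ := norm_pos_iff.2 hy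
      simp only [hD]
      rw [abs_mul, abs_mul _ (Kbar v y - _), abs_sq]
      calc _ ≤ (M * ‖d‖) ^ 2 * ((η (x + y) - η x) ^ 2 * (6 * Kbar v y / (1 + ‖y‖ ^ 2))) := by
            gcongr
            · exact hξξ _ _
            · exact abs_Kbar_sub_smoothKbar_le hβ1 hβ2 hv y
        _ = _ := by rw [hw]; field_simp)
  set F : R2 × R2 → ℝ := fun p => fderiv ℝ u p.1 d * fderiv ℝ u (p.1 + p.2) d *
        ((η (p.1 + p.2) - η p.1) ^ 2 * smoothKbar β p.2) with hF
  obtain ⟨iF, hle⟩ := hbound η hη hc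
  have : ∀ p : R2 × R2, fderiv ℝ u p.1 d * fderiv ℝ u (p.1 + p.2) d *
        ((η (p.1 + p.2) - η p.1) ^ 2 * Kbar v p.2) = D p + F p := fun p => by
    simp only [hD, hF]; ring
  simp_rw [this]
  rw [integral_add iD iF, add_mul]
  linarith [le_abs_self (∫ p, D p ∂(volume.prod volume)),
    le_abs_self (∫ p, F p ∂(volume.prod volume))]

/-! ### Bounded increments and the weak form of the operator -/

/-- The weight `|y|² / (1 + |y|²)`, comparable to `min 1 |y|²`. -/
def kap (y : R2) : ℝ := ‖y‖ ^ 2 / (1 + ‖y‖ ^ 2)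

lemma kap_nonneg (y : R2) : 0 ≤ kap y := by unfold kap; positivity

lemma kap_le_one (y : R2) : kap y ≤ 1 := by
  unfold kap
  rw [div_le_one (by positivity)]
  linarith

/-- Continuous functions whose first and second differences are controlled by `√(kap y)` and
`kap y`. -/
structure IsTame (g : R2 → ℝ) : Prop where
  cont : Continuous g
  diff : ∃ C, 0 ≤ C ∧ ∀ x y, |g (x + y) - g x| ≤ C * √(kap y)
  diff2 : ∃ C, 0 ≤ C ∧ ∀ x y, |g (x + y) + g (x - y) - 2 * g x| ≤ C * kap y

lemma norm_fderiv_sub_le {g : R2 → ℝ} (hg : ContDiff ℝ 2 g) {C : ℝ}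
    (hC : ∀ x, ‖iteratedFDeriv ℝ 2 g x‖ ≤ C) (x z : R2) :
    ‖fderiv ℝ g z - fderiv ℝ g x‖ ≤ C * ‖z - x‖ :=
  convex_univ.norm_image_sub_le_of_norm_fderiv_le
    (fun x _ => (hg.fderiv_right (m := 1) (by norm_num)).differentiable one_ne_zero x)
    (fun x _ => by rw [← norm_iteratedFDeriv_one, norm_iteratedFDeriv_fderiv]; exact hC x)
    (mem_univ x) (mem_univ z)

lemma isTame_of_contDiff {g : R2 → ℝ} (hg : ContDiff ℝ 2 g) {C : ℝ}
    (hC : ∀ x, |g x| ≤ C ∧ ‖fderiv ℝ g x‖ ≤ C ∧ ‖iteratedFDeriv ℝ 2 g x‖ ≤ C) : IsTame g := by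
  have hC0 : 0 ≤ C := (abs_nonneg _).trans (hC 0).1
  have hd1 : Differentiable ℝ g := hg.differentiable two_ne_zero
  have hlip : ∀ x z, |g z - g x| ≤ C * ‖z - x‖ := fun x z =>
    convex_univ.norm_image_sub_le_of_norm_fderiv_le (fun x _ => hd1 x) (fun x _ => (hC x).2.1)
      (mem_univ x) (mem_univ z)
  have hlip2 := norm_fderiv_sub_le hg fun x => (hC x).2.2
  refine ⟨hg.continuous, ⟨3 * C, by positivity, fun x y => ?_⟩, ⟨6 * C, by positivity,
    fun x y => ?_⟩⟩
  · have h1 : |g (x + y) - g x| ≤ C * ‖y‖ := by simpa using hlip x (x + y)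
    have h2 : |g (x + y) - g x| ≤ 2 * C := by
      linarith [abs_sub (g (x + y)) (g x), (hC x).1, (hC (x + y)).1]
    refine abs_le_of_sq_le_sq ?_ (by positivity)
    rw [mul_pow, sq_sqrt (kap_nonneg y), kap, ← mul_div_assoc, le_div_iff₀ (by positivity)]
    have h1' := pow_le_pow_left₀ (abs_nonneg _) h1 2
    have h2' := pow_le_pow_left₀ (abs_nonneg _) h2 2
    rw [sq_abs] at h1' h2'
    nlinarith [mul_le_mul_of_nonneg_right h2' (sq_nonneg ‖y‖), sq_nonneg (C * ‖y‖)]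
  · have h1 : |g (x + y) + g (x - y) - 2 * g x| ≤ 2 * C * ‖y‖ ^ 2 := by
      have hder : ∀ t : ℝ, HasDerivAt (fun t : ℝ => g (x + t • y) + g (x - t • y))
          (fderiv ℝ g (x + t • y) y - fderiv ℝ g (x - t • y) y) t := fun t => by
        have ha := (hd1 (x + t • y)).hasFDerivAt.comp_hasDerivAt t
          (((hasDerivAt_id t).smul_const y).const_add x)
        have hb := (hd1 (x - t • y)).hasFDerivAt.comp_hasDerivAt t
          (((hasDerivAt_id t).smul_const y).const_sub x)
        refine (ha.add hb).congr_deriv ?_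
        simp [sub_eq_add_neg]
      have := norm_image_sub_le_of_norm_deriv_le_segment_01' (C := 2 * C * ‖y‖ ^ 2)
        (fun t _ => (hder t).hasDerivWithinAt) fun t ht => by
          rw [← sub_apply]
          calc _ ≤ ‖fderiv ℝ g (x + t • y) - fderiv ℝ g (x - t • y)‖ * ‖y‖ :=
                ContinuousLinearMap.le_opNorm _ _
            _ ≤ C * ‖(x + t • y) - (x - t • y)‖ * ‖y‖ := by gcongr; exact hlip2 _ _
            _ = C * (2 * t * ‖y‖) * ‖y‖ := by
                rw [show (x + t • y) - (x - t • y) = (2 * t) • y by module, norm_smul,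
                  norm_of_nonneg (by linarith [ht.1])]
            _ ≤ C * (2 * 1 * ‖y‖) * ‖y‖ := by gcongr; exact ht.2.le
            _ = _ := by ring
      simp only [one_smul, zero_smul, add_zero, sub_zero] at this
      rwa [norm_eq_abs, ← two_mul] at this
    have h2 : |g (x + y) + g (x - y) - 2 * g x| ≤ 4 * C := by
      have := abs_sub (g (x + y) + g (x - y)) (2 * g x)
      have h3 := abs_add_le (g (x + y)) (g (x - y))
      rw [abs_mul, abs_two] at this
      linarith [(hC x).1, (hC (x + y)).1, (hC (x - y)).1]
    rw [kap, ← mul_div_assoc, le_div_iff₀ (by positivity)]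
    nlinarith [mul_le_mul_of_nonneg_right h2 (sq_nonneg ‖y‖)]

lemma isTame_of_hasCompactSupport {g : R2 → ℝ} (hg : ContDiff ℝ 2 g)
    (hc : HasCompactSupport g) : IsTame g := by
  obtain ⟨A, hA⟩ := hg.continuous.bounded_above_of_compact_support hc
  obtain ⟨B, hB⟩ := (hg.continuous_fderiv two_ne_zero).bounded_above_of_compact_support
    (hc.fderiv ℝ)
  obtain ⟨D, hD⟩ := (hg.continuous_iteratedFDeriv (m := 2) le_rfl).bounded_above_of_compact_support
    (hc.iteratedFDeriv 2)
  exact isTame_of_contDiff hg (C := max A (max B D)) fun x =>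
    ⟨(hA x).trans (le_max_left _ _), (hB x).trans ((le_max_left _ _).trans (le_max_right _ _)),
      (hD x).trans ((le_max_right _ _).trans (le_max_right _ _))⟩

lemma IsTame.comp_add_right {g : R2 → ℝ} (hg : IsTame g) (z : R2) :
    IsTame (fun x => g (x + z)) := by
  obtain ⟨hc, ⟨A, hA, h1⟩, ⟨B, hB, h2⟩⟩ := hg
  refine ⟨by fun_prop, ⟨A, hA, fun x y => ?_⟩, ⟨B, hB, fun x y => ?_⟩⟩
  · simpa only [add_right_comm] using h1 (x + z) y
  · simpa only [add_right_comm, sub_add_eq_add_sub] using h2 (x + z) y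

lemma IsTame.const_mul {g : R2 → ℝ} (hg : IsTame g) (c : ℝ) : IsTame (fun x => c * g x) := by
  obtain ⟨hc, ⟨A, hA, h1⟩, ⟨B, hB, h2⟩⟩ := hg
  refine ⟨by fun_prop, ⟨|c| * A, by positivity, fun x y => ?_⟩,
    ⟨|c| * B, by positivity, fun x y => ?_⟩⟩
  · rw [← mul_sub, abs_mul, mul_assoc]
    exact mul_le_mul_of_nonneg_left (h1 x y) (abs_nonneg c)
  · rw [show c * g (x + y) + c * g (x - y) - 2 * (c * g x) =
      c * (g (x + y) + g (x - y) - 2 * g x) by ring, abs_mul, mul_assoc]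
    exact mul_le_mul_of_nonneg_left (h2 x y) (abs_nonneg c)

lemma IsTame.sub {f g : R2 → ℝ} (hf : IsTame f) (hg : IsTame g) :
    IsTame (fun x => f x - g x) := by
  obtain ⟨hc, ⟨A, hA, h1⟩, ⟨B, hB, h2⟩⟩ := hg
  obtain ⟨hc', ⟨A', hA', h1'⟩, ⟨B', hB', h2'⟩⟩ := hf
  refine ⟨by fun_prop, ⟨A' + A, by positivity, fun x y => ?_⟩,
    ⟨B' + B, by positivity, fun x y => ?_⟩⟩
  · rw [show f (x + y) - g (x + y) - (f x - g x) = (f (x + y) - f x) - (g (x + y) - g x) by ring,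
      add_mul]
    exact (abs_sub _ _).trans (add_le_add (h1' x y) (h1 x y))
  · rw [show f (x + y) - g (x + y) + (f (x - y) - g (x - y)) - 2 * (f x - g x) =
      (f (x + y) + f (x - y) - 2 * f x) - (g (x + y) + g (x - y) - 2 * g x) by ring, add_mul]
    exact (abs_sub _ _).trans (add_le_add (h2' x y) (h2 x y))

lemma IsTame.integrable {g : R2 → ℝ} (hg : IsTame g) {v : ℝ → ℝ} (hv : Continuous v)
    (hK : Integrable fun y => Kbar v y * kap y) (x : R2) :
    Integrable fun y => (g (x + y) + g (x - y) - 2 * g x) * Kbar v y := by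
  obtain ⟨hc, -, ⟨B, hB, h2⟩⟩ := hg
  refine (hK.norm.const_mul B).mono' ?_ (ae_of_all _ fun y => ?_)
  · exact (Continuous.aestronglyMeasurable (by fun_prop)).mul
      (measurable_Kbar hv).aestronglyMeasurable
  · rw [norm_mul, norm_mul, norm_of_nonneg (kap_nonneg y), norm_eq_abs]
    calc _ ≤ B * kap y * ‖Kbar v y‖ := by gcongr; exact h2 x y
      _ = _ := by ring

lemma Lop_sub_const_mul {f g : R2 → ℝ} (hf : IsTame f) (hg : IsTame g) {v : ℝ → ℝ}
    (hv : Continuous v) (hK : Integrable fun y => Kbar v y * kap y) (c : ℝ) (x : R2) :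
    Lop v (fun x => c * (f x - g x)) x = c * (Lop v f x - Lop v g x) := by
  unfold Lop
  have : ∀ y, (c * (f (x + y) - g (x + y)) + c * (f (x - y) - g (x - y)) -
      2 * (c * (f x - g x))) * Kbar v y =
      c * ((f (x + y) + f (x - y) - 2 * f x) * Kbar v y -
        (g (x + y) + g (x - y) - 2 * g x) * Kbar v y) := fun y => by ring
  simp_rw [this]
  rw [integral_const_mul, integral_sub (hf.integrable hv hK x) (hg.integrable hv hK x)]
  ring

lemma Lop_comp_add_right (g : R2 → ℝ) (v : ℝ → ℝ) (z x : R2) :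
    Lop v (fun x => g (x + z)) x = Lop v g (x + z) := by
  unfold Lop
  simp only [add_right_comm, sub_add_eq_add_sub]

lemma integral_second_difference_mul {g ψ : R2 → ℝ} (hg : Continuous g) (hψ : Continuous ψ)
    (hc : HasCompactSupport ψ) (y : R2) :
    ∫ x, (g (x + y) + g (x - y) - 2 * g x) * ψ x =
      -∫ x, (g (x + y) - g x) * (ψ (x + y) - ψ x) := by
  have hi : ∀ f : R2 → ℝ, Continuous f → Integrable fun x => f x * ψ x := fun f hf =>
    Continuous.integrable_of_hasCompactSupport (by fun_prop) hc.mul_left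
  have hcy : HasCompactSupport fun x => ψ (x + y) := hc.comp_add_right y
  have hi' : ∀ f : R2 → ℝ, Continuous f → Integrable fun x => f x * ψ (x + y) := fun f hf =>
    Continuous.integrable_of_hasCompactSupport (by fun_prop) hcy.mul_left
  have i1 := hi (fun x => g (x + y)) (by fun_prop)
  have i2 := hi (fun x => g (x - y)) (by fun_prop)
  have i3 := hi g hg
  have i4 := hi' (fun x => g (x + y)) (by fun_prop)
  have i5 := hi' g hg
  have e4 : ∫ x, g (x + y) * ψ (x + y) = ∫ x, g x * ψ x :=
    integral_add_right_eq_self (fun x => g x * ψ x) y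
  have e5 : ∫ x, g x * ψ (x + y) = ∫ x, g (x - y) * ψ x := by
    have := integral_sub_right_eq_self (μ := volume) (fun x => g x * ψ (x + y)) y
    simp only [sub_add_cancel] at this
    exact this.symm
  have l1 : ∀ x, (g (x + y) + g (x - y) - 2 * g x) * ψ x =
      g (x + y) * ψ x + g (x - y) * ψ x - 2 * (g x * ψ x) := fun x => by ring
  have l2 : ∀ x, (g (x + y) - g x) * (ψ (x + y) - ψ x) =
      g (x + y) * ψ (x + y) + g x * ψ x - (g (x + y) * ψ x + g x * ψ (x + y)) := fun x => by ring
  have i12 : Integrable fun x => g (x + y) * ψ x + g (x - y) * ψ x := i1.add i2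
  have i43 : Integrable fun x => g (x + y) * ψ (x + y) + g x * ψ x := i4.add i3
  have i15 : Integrable fun x => g (x + y) * ψ x + g x * ψ (x + y) := i1.add i5
  simp_rw [l1, l2]
  rw [integral_sub i12 (i3.const_mul 2), integral_add i1 i2, integral_const_mul,
    integral_sub i43 i15, integral_add i4 i3, integral_add i1 i5, e4, e5]
  ring

lemma Lop_weak_form {g ψ : R2 → ℝ} (hg : IsTame g) (hψ : IsTame ψ) (hc : HasCompactSupport ψ)
    {v : ℝ → ℝ} (hv : Continuous v) (hK : Integrable fun y => Kbar v y * kap y)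
    (hK0 : ∀ y, 0 ≤ Kbar v y) :
    Integrable (fun x => Lop v g x * ψ x) ∧
    Integrable (fun p : R2 × R2 => (g (p.1 + p.2) - g p.1) * (ψ (p.1 + p.2) - ψ p.1) * Kbar v p.2)
      (volume.prod volume) ∧
    ∫ x, Lop v g x * ψ x = 1 / (4 * π) * ∫ p : R2 × R2,
      (g (p.1 + p.2) - g p.1) * (ψ (p.1 + p.2) - ψ p.1) * Kbar v p.2 ∂(volume.prod volume) := by
  obtain ⟨hgc, ⟨A, hA, h1⟩, ⟨B, hB, h2⟩⟩ := hg
  obtain ⟨hψc, ⟨A', hA', h1'⟩, -⟩ := hψ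
  have hKm : Measurable fun p : R2 × R2 => Kbar v p.2 := (measurable_Kbar hv).comp measurable_snd
  have hKk0 : ∀ y, 0 ≤ Kbar v y * kap y := fun y => mul_nonneg (hK0 y) (kap_nonneg y)
  have hψi : Integrable ψ := hψc.integrable_of_hasCompactSupport hc
  have iH : Integrable (fun p : R2 × R2 =>
      (g (p.1 + p.2) + g (p.1 - p.2) - 2 * g p.1) * ψ p.1 * Kbar v p.2) (volume.prod volume) := by
    have hcont : Continuous fun p : R2 × R2 =>
      (g (p.1 + p.2) + g (p.1 - p.2) - 2 * g p.1) * ψ p.1 := by fun_prop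
    refine (integrable_prod_of_weight (S := fun x _ => B * |ψ x|) (c := ∫ x, B * |ψ x|)
      (hcont.measurable.mul hKm).aestronglyMeasurable hK hKk0 (fun _ => hψi.abs.const_mul B)
      (fun _ => le_rfl) fun x y => ?_).1
    simp only [Pi.mul_apply, abs_mul, abs_of_nonneg (hK0 y)]
    calc _ ≤ B * kap y * |ψ x| * Kbar v y := by
          gcongr
          · exact hK0 y
          · exact h2 x y
      _ = _ := by ring
  have iG : Integrable (fun p : R2 × R2 =>
      (g (p.1 + p.2) - g p.1) * (ψ (p.1 + p.2) - ψ p.1) * Kbar v p.2) (volume.prod volume) := by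
    have hcont : Continuous fun p : R2 × R2 =>
      (g (p.1 + p.2) - g p.1) * (ψ (p.1 + p.2) - ψ p.1) := by fun_prop
    set T := tsupport ψ with hT
    set χ : R2 → ℝ := T.indicator (fun _ => A * A') with hχ
    have hχi : Integrable χ := (integrable_indicator_iff (isClosed_tsupport ψ).measurableSet).2
      (integrableOn_const (hs := hc.measure_lt_top.ne))
    have hχ0 : ∀ x, 0 ≤ χ x := fun x => indicator_nonneg (fun _ _ => by positivity) x
    refine (integrable_prod_of_weight (S := fun x y => χ (x + y) + χ x)
      (c := (∫ x, χ x) + ∫ x, χ x)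
      (hcont.measurable.mul hKm).aestronglyMeasurable hK hKk0
      (fun y => (hχi.comp_add_right y).add hχi)
      (fun y => by
        rw [integral_add (hχi.comp_add_right y) hχi, integral_add_right_eq_self χ])
      fun x y => ?_).1
    simp only [Pi.mul_apply, abs_mul, abs_of_nonneg (hK0 y)]
    by_cases hx : x + y ∈ T ∨ x ∈ T
    · have hle : A * A' ≤ χ (x + y) + χ x := by
        rcases hx with hx | hx
        · have : χ (x + y) = A * A' := indicator_of_mem hx _
          linarith [hχ0 x]
        · have : χ x = A * A' := indicator_of_mem hx _
          linarith [hχ0 (x + y)]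
      calc _ ≤ (A * √(kap y)) * (A' * √(kap y)) * Kbar v y := by
            gcongr
            · exact hK0 y
            · exact h1 x y
            · exact h1' x y
        _ = Kbar v y * kap y * (A * A') := by
            rw [show (A * √(kap y)) * (A' * √(kap y)) = A * A' * (√(kap y) * √(kap y)) by ring,
              mul_self_sqrt (kap_nonneg y)]
            ring
        _ ≤ _ := mul_le_mul_of_nonneg_left hle (hKk0 y)
    · push Not at hx
      rw [image_eq_zero_of_notMem_tsupport hx.1, image_eq_zero_of_notMem_tsupport hx.2]
      simp only [sub_self, abs_zero, mul_zero, zero_mul]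
      exact mul_nonneg (hKk0 y) (add_nonneg (hχ0 _) (hχ0 _))
  have hL : ∀ x, Lop v g x * ψ x = -(1 / (4 * π)) *
      ∫ y, (g (x + y) + g (x - y) - 2 * g x) * ψ x * Kbar v y := fun x => by
    rw [Lop, mul_assoc, ← integral_mul_const]
    congr 2
    ext y
    ring
  simp_rw [hL]
  refine ⟨iH.integral_prod_left.const_mul _, iG, ?_⟩
  rw [integral_const_mul, ← integral_prod _ iH, integral_prod_symm _ iH, integral_prod_symm _ iG]
  simp only [integral_mul_const, integral_second_difference_mul hgc hψc hc, neg_mul, integral_neg,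
    mul_neg, neg_neg]

/-! ### The stability inequality -/

lemma sq_sub_sqrt_mul_le {a b p q h : ℝ} (hp : 0 ≤ p) (hq : 0 ≤ q) :
    (√(b ^ 2 + h ^ 2) * q - √(a ^ 2 + h ^ 2) * p) ^ 2 + 2 * (p * q) * (|a * b| - a * b) ≤
      (b - a) * (b * q ^ 2 - a * p ^ 2) + a * b * (q - p) ^ 2 + h ^ 2 * (q - p) ^ 2 := by
  have hA := sq_sqrt (by positivity : 0 ≤ a ^ 2 + h ^ 2)
  have hB := sq_sqrt (by positivity : 0 ≤ b ^ 2 + h ^ 2)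
  have hAB : |a * b| + h ^ 2 ≤ √(a ^ 2 + h ^ 2) * √(b ^ 2 + h ^ 2) := by
    rw [← sqrt_mul (by positivity)]
    apply le_sqrt_of_sq_le
    rw [abs_mul]
    nlinarith [sq_nonneg (|a| * h - |b| * h), sq_abs a, sq_abs b,
      show (|a| * |b|) ^ 2 = a ^ 2 * b ^ 2 by rw [mul_pow, sq_abs, sq_abs]]
  have : (√(b ^ 2 + h ^ 2) * q - √(a ^ 2 + h ^ 2) * p) ^ 2 =
      (b ^ 2 + h ^ 2) * q ^ 2 + (a ^ 2 + h ^ 2) * p ^ 2 -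
        2 * (p * q) * (√(a ^ 2 + h ^ 2) * √(b ^ 2 + h ^ 2)) := by
    linear_combination q ^ 2 * hB + p ^ 2 * hA
  rw [this]
  nlinarith [mul_le_mul_of_nonneg_left hAB (mul_nonneg hp hq)]

lemma integral_le_of_stable {v : ℝ → ℝ} (hv : Continuous v)
    (hK : Integrable fun y => Kbar v y * kap y) (hK0 : ∀ y, 0 ≤ Kbar v y) {V w η : R2 → ℝ}
    (hV : Continuous V)
    (hstab : ∀ φ : R2 → ℝ, ContDiff ℝ 2 φ → HasCompactSupport φ →
      0 ≤ ∫ x, (Lop v φ x + V x * φ x) * φ x)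
    (hw : ContDiff ℝ 2 w) (hwt : IsTame w) (hη : ContDiff ℝ 2 η) (hc : HasCompactSupport η)
    (hη0 : ∀ x, 0 ≤ η x) {h : ℝ} (hh : 0 < h) {m : R2 × R2 → ℝ}
    (hm : Integrable m (volume.prod volume))
    (hmle : ∀ x y, m (x, y) ≤
      2 * (η x * η (x + y)) * (|w x * w (x + y)| - w x * w (x + y)) * Kbar v y)
    (hP : Integrable (fun p : R2 × R2 => w p.1 * w (p.1 + p.2) *
      ((η (p.1 + p.2) - η p.1) ^ 2 * Kbar v p.2)) (volume.prod volume))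
    (hD : Integrable (fun p : R2 × R2 => (η (p.1 + p.2) - η p.1) ^ 2 * Kbar v p.2)
      (volume.prod volume)) :
    ∫ p, m p ∂(volume.prod volume) ≤
      4 * π * (∫ x, (Lop v w x * w x + V x * (w x ^ 2 + h ^ 2)) * η x ^ 2) +
      (∫ p : R2 × R2, w p.1 * w (p.1 + p.2) * ((η (p.1 + p.2) - η p.1) ^ 2 * Kbar v p.2)
        ∂(volume.prod volume)) +
      h ^ 2 * ∫ p : R2 × R2, (η (p.1 + p.2) - η p.1) ^ 2 * Kbar v p.2 ∂(volume.prod volume) := by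
  set φ : R2 → ℝ := fun x => √(w x ^ 2 + h ^ 2) * η x with hφ
  have hφd : ContDiff ℝ 2 φ :=
    (((hw.pow 2).add contDiff_const).sqrt fun x => by positivity).mul hη
  have hφc : HasCompactSupport φ := hc.mul_left
  set ψ : R2 → ℝ := fun x => w x * η x ^ 2 with hψ
  have hψd : ContDiff ℝ 2 ψ := hw.mul (hη.pow 2)
  have hψc : HasCompactSupport ψ := hc.sq_of.mul_left
  have hφt := isTame_of_hasCompactSupport hφd hφc
  obtain ⟨i1, i2, e1⟩ := Lop_weak_form hφt hφt hφc hv hK hK0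
  obtain ⟨j1, j2, e2⟩ := Lop_weak_form hwt (isTame_of_hasCompactSupport hψd hψc) hψc hv hK hK0
  have hφcont := hφd.continuous
  have hηcont := hη.continuous
  have hwcont := hw.continuous
  have iV : Integrable fun x => V x * (w x ^ 2 + h ^ 2) * η x ^ 2 :=
    Continuous.integrable_of_hasCompactSupport (by fun_prop) hc.sq_of.mul_left
  have hs := hstab φ hφd hφc
  have hφ2 : ∀ x, (Lop v φ x + V x * φ x) * φ x =
      Lop v φ x * φ x + V x * (w x ^ 2 + h ^ 2) * η x ^ 2 := fun x => by
    have : φ x ^ 2 = (w x ^ 2 + h ^ 2) * η x ^ 2 := by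
      rw [hφ, mul_pow, sq_sqrt (by positivity)]
    linear_combination V x * this
  have hψ2 : ∀ x, (Lop v w x * w x + V x * (w x ^ 2 + h ^ 2)) * η x ^ 2 =
      Lop v w x * ψ x + V x * (w x ^ 2 + h ^ 2) * η x ^ 2 := fun x => by rw [hψ]; ring
  simp_rw [hφ2] at hs
  simp_rw [hψ2]
  rw [integral_add i1 iV, e1] at hs
  rw [integral_add j1 iV, e2]
  have hmono : (∫ p : R2 × R2, (φ (p.1 + p.2) - φ p.1) * (φ (p.1 + p.2) - φ p.1) * Kbar v p.2
        ∂(volume.prod volume)) + ∫ p, m p ∂(volume.prod volume) ≤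
      (∫ p : R2 × R2, (w (p.1 + p.2) - w p.1) * (ψ (p.1 + p.2) - ψ p.1) * Kbar v p.2
        ∂(volume.prod volume)) +
      ((∫ p : R2 × R2, w p.1 * w (p.1 + p.2) * ((η (p.1 + p.2) - η p.1) ^ 2 * Kbar v p.2)
        ∂(volume.prod volume)) +
      h ^ 2 * ∫ p : R2 × R2, (η (p.1 + p.2) - η p.1) ^ 2 * Kbar v p.2
        ∂(volume.prod volume)) := by
    have hPD : Integrable (fun p : R2 × R2 => w p.1 * w (p.1 + p.2) *
        ((η (p.1 + p.2) - η p.1) ^ 2 * Kbar v p.2) +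
        h ^ 2 * ((η (p.1 + p.2) - η p.1) ^ 2 * Kbar v p.2)) (volume.prod volume) :=
      hP.add (hD.const_mul _)
    rw [← integral_const_mul, ← integral_add hP (hD.const_mul _), ← integral_add i2 hm,
      ← integral_add j2 hPD]
    refine integral_mono (i2.add hm) (j2.add hPD) fun p => ?_
    have h1 := mul_le_mul_of_nonneg_right (sq_sub_sqrt_mul_le (a := w p.1) (b := w (p.1 + p.2))
      (h := h) (hη0 p.1) (hη0 (p.1 + p.2))) (hK0 p.2)
    have h2 := hmle p.1 p.2
    simp only [hφ, hψ]
    linarith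
  have hπ : 0 < 4 * π := by positivity
  have hs' := mul_nonneg hπ.le hs
  rw [mul_add, ← mul_assoc, mul_one_div_cancel hπ.ne', one_mul] at hs' ⊢
  linarith

/-! ### Difference quotients -/

lemma abs_diff_quot_le {u : R2 → ℝ} (hu : ContDiff ℝ 2 u) {C : ℝ}
    (hC : ∀ x, ‖fderiv ℝ u x‖ ≤ C) (d x : R2) {h : ℝ} (hh : 0 < h) :
    |u (x + h • d) - u x| ≤ C * ‖d‖ * h := by
  have := convex_univ.norm_image_sub_le_of_norm_fderiv_le
    (fun x _ => hu.differentiable two_ne_zero x) (fun x _ => hC x)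
    (mem_univ x) (mem_univ (x + h • d))
  rw [add_sub_cancel_left, norm_smul, norm_of_nonneg hh.le, norm_eq_abs] at this
  linarith

lemma abs_diff_quot_sub_fderiv_le {u : R2 → ℝ} (hu : ContDiff ℝ 2 u) {C : ℝ}
    (hC : ∀ x, ‖iteratedFDeriv ℝ 2 u x‖ ≤ C) (d x : R2) {h : ℝ} (hh : 0 < h) :
    |h⁻¹ * (u (x + h • d) - u x) - fderiv ℝ u x d| ≤ C * ‖d‖ ^ 2 * h := by
  have hC0 : 0 ≤ C := (norm_nonneg _).trans (hC 0)
  have hn : ‖h • d‖ = h * ‖d‖ := by rw [norm_smul, norm_of_nonneg hh.le]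
  have := (convex_closedBall x (h * ‖d‖)).norm_image_sub_le_of_norm_fderiv_le'
    (f := u) (φ := fderiv ℝ u x) (C := C * (h * ‖d‖)) (x := x) (y := x + h • d)
    (fun x _ => hu.differentiable two_ne_zero x)
    (fun z hz => (norm_fderiv_sub_le hu hC x z).trans (by
      gcongr
      rw [← dist_eq_norm]
      exact hz))
    (Metric.mem_closedBall_self (by positivity)) (by simp [hn])
  rw [add_sub_cancel_left, hn, map_smul, smul_eq_mul, norm_eq_abs] at this
  rw [show h⁻¹ * (u (x + h • d) - u x) - fderiv ℝ u x d =
    h⁻¹ * (u (x + h • d) - u x - h * fderiv ℝ u x d) by field_simp, abs_mul,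
    abs_of_pos (inv_pos.2 hh), inv_mul_le_iff₀ hh]
  linarith

lemma abs_taylor_le_of_holderWith {f : ℝ → ℝ} (hf : Differentiable ℝ f) {K α : ℝ≥0}
    (hK : HolderWith K α (deriv f)) (s t : ℝ) :
    |f t - f s - deriv f s * (t - s)| ≤ K * |t - s| ^ (α : ℝ) * |t - s| := by
  have := (convex_uIcc s t).norm_image_sub_le_of_norm_hasDerivWithin_le
    (f := fun r => f r - deriv f s * r) (f' := fun r => deriv f r - deriv f s)
    (C := K * |t - s| ^ (α : ℝ)) (x := s) (y := t)
    (fun r _ => ((hf r).hasDerivAt.sub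
      (by simpa using (hasDerivAt_id r).const_mul (deriv f s))).hasDerivWithinAt)
    (fun r hr => by
      have h := hK.dist_le r s
      rw [dist_eq_norm, Real.dist_eq] at h
      exact h.trans (mul_le_mul_of_nonneg_left (rpow_le_rpow (abs_nonneg _)
        (abs_sub_left_of_mem_uIcc hr) α.2) K.2))
    left_mem_uIcc right_mem_uIcc
  rw [norm_eq_abs, norm_eq_abs] at this
  convert this using 2
  ring

lemma integrable_sq_sub_mul_Kbar {v : ℝ → ℝ} (hv : Continuous v)
    (hK : Integrable fun y => Kbar v y * kap y) (hK0 : ∀ y, 0 ≤ Kbar v y) {η : R2 → ℝ}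
    (hη : ContDiff ℝ 1 η) (hc : HasCompactSupport η) :
    Integrable (fun p : R2 × R2 => (η (p.1 + p.2) - η p.1) ^ 2 * Kbar v p.2)
      (volume.prod volume) := by
  have hηc := hη.continuous
  have hi := integrable_sq_sub_translate hηc hc
  set E := ∫ x, ‖fderiv ℝ η x‖ ^ 2
  have hE0 : 0 ≤ E := integral_nonneg fun x => sq_nonneg _
  refine (integrable_prod_of_weight (w := fun y => Kbar v y * kap y)
    (S := fun x y => (η (x + y) - η x) ^ 2 + (η (x + y) - η x) ^ 2 / ‖y‖ ^ 2)
    (c := 4 * (∫ x, η x ^ 2) + E) ?_ hK (fun y => mul_nonneg (hK0 y) (kap_nonneg y))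
    (fun y => (hi y).add ((hi y).div_const _)) (fun y => ?_) fun x y => ?_).1
  · have h1 : Continuous fun p : R2 × R2 => (η (p.1 + p.2) - η p.1) ^ 2 := by fun_prop
    exact (h1.measurable.mul ((measurable_Kbar hv).comp measurable_snd)).aestronglyMeasurable
  · rw [integral_add (hi y) ((hi y).div_const _), integral_div]
    refine add_le_add (integral_sq_sub_translate_le_four hηc hc y) ?_
    rcases eq_or_ne y 0 with rfl | hy
    · simpa using hE0
    have : 0 < ‖y‖ := norm_pos_iff.2 hy
    rw [div_le_iff₀ (by positivity), mul_comm]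
    exact integral_sq_sub_translate_le hη hc y
  · rcases eq_or_ne y 0 with rfl | hy
    · simp
    have : 0 < ‖y‖ := norm_pos_iff.2 hy
    rw [abs_of_nonneg (mul_nonneg (sq_nonneg _) (hK0 y)), kap]
    apply le_of_eq
    field_simp
    ring

/-! ### Passing to the limit in the stability inequality -/

lemma integral_le_of_stable_fderiv {β : ℝ} {v W : ℝ → ℝ} {u : R2 → ℝ} (hβ : 0 < β)
    (hv : Continuous v) (hK : Integrable fun y => Kbar v y * kap y) (hK0 : ∀ y, 0 ≤ Kbar v y)
    {α : ℝ≥0} (hW : PotentialAssump α W) (hu : IsStableSolution β v W u) (d : R2)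
    {η : R2 → ℝ} (hη : ContDiff ℝ 2 η) (hc : HasCompactSupport η) (hη0 : ∀ x, 0 ≤ η x)
    {m : R2 × R2 → ℝ} (hm : Integrable m (volume.prod volume))
    (hmle : ∀ᶠ h in 𝓝[>] (0:ℝ), ∀ x y, m (x, y) ≤ 2 * (η x * η (x + y)) *
      (|h⁻¹ * (u (x + h • d) - u x) * (h⁻¹ * (u (x + y + h • d) - u (x + y)))| -
        h⁻¹ * (u (x + h • d) - u x) * (h⁻¹ * (u (x + y + h • d) - u (x + y)))) * Kbar v y) :
    ∫ p, m p ∂(volume.prod volume) ≤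
      ∫ p : R2 × R2, fderiv ℝ u p.1 d * fderiv ℝ u (p.1 + p.2) d *
        ((η (p.1 + p.2) - η p.1) ^ 2 * Kbar v p.2) ∂(volume.prod volume) := by
  obtain ⟨hud, ⟨C, hC⟩, heq, -, hstab⟩ := hu
  obtain ⟨hWd, hα, -, ⟨G, hG⟩, ⟨Cα, hCα⟩, -⟩ := hW
  set b : ℝ := β ^ (-(1:ℝ) / 2)
  have hb : 0 < b := rpow_pos_of_pos hβ _
  have hC0 : 0 ≤ C := (abs_nonneg _).trans (hC 0).1
  have hG0 : 0 ≤ G := (abs_nonneg _).trans (hG 0).1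
  set B := C * ‖d‖
  have hB0 : 0 ≤ B := by positivity
  set L := C * ‖d‖ ^ 2
  have hL0 : 0 ≤ L := by positivity
  have hW1 : ContDiff ℝ 1 (deriv W) := ((contDiff_succ_iff_deriv (n := 1)).1 hWd).2.2
  have hut := isTame_of_contDiff hud hC
  have hηc := hη.continuous
  have huc := hud.continuous
  have hduc := hud.continuous_fderiv two_ne_zero
  have hKm : Measurable fun p : R2 × R2 => Kbar v p.2 := (measurable_Kbar hv).comp measurable_snd
  have hD := integrable_sq_sub_mul_Kbar hv hK hK0 (hη.of_le one_le_two) hc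
  set D : R2 × R2 → ℝ := fun p => (η (p.1 + p.2) - η p.1) ^ 2 * Kbar v p.2 with hDdef
  have hD0 : ∀ p, 0 ≤ D p := fun p => mul_nonneg (sq_nonneg _) (hK0 _)
  have hξ : ∀ x, |fderiv ℝ u x d| ≤ B := fun x =>
    ((fderiv ℝ u x).le_opNorm d).trans (mul_le_mul_of_nonneg_right (hC x).2.1 (norm_nonneg d))
  have hmul : ∀ g : R2 → ℝ, Continuous g → (∀ x, |g x| ≤ B) →
      Integrable (fun p : R2 × R2 => g p.1 * g (p.1 + p.2) * D p) (volume.prod volume) :=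
    fun g hg hgB => hD.bdd_mul (c := B * B)
      (Continuous.aestronglyMeasurable (by fun_prop)) (ae_of_all _ fun p => by
        rw [norm_mul]
        exact mul_le_mul (hgB _) (hgB _) (norm_nonneg _) hB0)
  have hξi := hmul (fun x => fderiv ℝ u x d) (by fun_prop) hξ
  set R : ℝ → ℝ := fun h => b * (Cα * (B * h) ^ (α:ℝ) * B ^ 2 + G * h ^ 2) with hR
  have hηi : Integrable fun x => η x ^ 2 :=
    Continuous.integrable_of_hasCompactSupport (by fun_prop) hc.sq_of
  have key : ∀ᶠ h in 𝓝[>] (0:ℝ), ∫ p, m p ∂(volume.prod volume) ≤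
      4 * π * (R h * ∫ x, η x ^ 2) +
      ((∫ p : R2 × R2, fderiv ℝ u p.1 d * fderiv ℝ u (p.1 + p.2) d * D p ∂(volume.prod volume)) +
        2 * B * L * h * ∫ p, D p ∂(volume.prod volume)) +
      h ^ 2 * ∫ p, D p ∂(volume.prod volume) := by
    filter_upwards [hmle, self_mem_nhdsWithin] with h hmh hh
    rw [mem_Ioi] at hh
    set w : R2 → ℝ := fun x => h⁻¹ * (u (x + h • d) - u x) with hwdef
    have hΔ : ∀ x, |u (x + h • d) - u x| ≤ B * h := fun x =>
      abs_diff_quot_le hud (fun x => (hC x).2.1) d x hh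
    have hwB : ∀ x, |w x| ≤ B := fun x => by
      rw [hwdef, abs_mul, abs_of_pos (inv_pos.2 hh), inv_mul_le_iff₀ hh]
      linarith [hΔ x]
    have hwξ : ∀ x, |w x - fderiv ℝ u x d| ≤ L * h := fun x =>
      abs_diff_quot_sub_fderiv_le hud (fun x => (hC x).2.2) d x hh
    have hwd : ContDiff ℝ 2 w := by fun_prop
    have hwc := hwd.continuous
    have hwt : IsTame w := ((hut.comp_add_right _).sub hut).const_mul _
    have hLop : ∀ x, Lop v w x = -b * (h⁻¹ * (deriv W (u (x + h • d)) - deriv W (u x))) :=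
      fun x => by
        rw [hwdef, Lop_sub_const_mul (hut.comp_add_right _) hut hv hK, Lop_comp_add_right,
          heq, heq]
        ring
    have hpot : ∀ x, Lop v w x * w x + b * deriv (deriv W) (u x) * (w x ^ 2 + h ^ 2) ≤ R h := by
      intro x
      have hT := abs_taylor_le_of_holderWith (hW1.differentiable one_ne_zero) hCα (u x)
        (u (x + h • d))
      set T := deriv W (u (x + h • d)) - deriv W (u x) -
        deriv (deriv W) (u x) * (u (x + h • d) - u x)
      have hT' : |T| ≤ Cα * (B * h) ^ (α:ℝ) * (B * h) := hT.trans (by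
        gcongr
        · exact hΔ x
        · exact hΔ x)
      have e : Lop v w x * w x + b * deriv (deriv W) (u x) * (w x ^ 2 + h ^ 2) =
          b * (-(h⁻¹ * T) * w x + deriv (deriv W) (u x) * h ^ 2) := by
        rw [hLop]
        simp only [hwdef, T]
        ring
      have h1 : -(h⁻¹ * T) * w x ≤ Cα * (B * h) ^ (α:ℝ) * B ^ 2 := by
        refine (le_abs_self _).trans ?_
        rw [abs_mul, abs_neg, abs_mul, abs_of_pos (inv_pos.2 hh)]
        calc _ ≤ h⁻¹ * (Cα * (B * h) ^ (α:ℝ) * (B * h)) * B := by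
              gcongr
              exact hwB x
          _ = _ := by field_simp
      rw [e]
      refine mul_le_mul_of_nonneg_left (add_le_add h1 ?_) hb.le
      exact mul_le_mul_of_nonneg_right ((le_abs_self _).trans (hG _).2.2) (sq_nonneg h)
    have hst := integral_le_of_stable hv hK hK0 (V := fun x => b * deriv (deriv W) (u x))
      ((hW1.continuous_deriv le_rfl).comp huc |>.const_mul b) hstab hwd hwt hη hc hη0 hh hm hmh
      (hmul w hwc hwB) hD
    refine hst.trans ?_
    gcongr ?_ + ?_ + _
    · gcongr 4 * π * ?_
      rw [← integral_const_mul]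
      refine integral_mono ?_ (hηi.const_mul _) fun x =>
        mul_le_mul_of_nonneg_right (hpot x) (sq_nonneg _)
      have hW2 := hW1.continuous_deriv le_rfl
      have hW1c := hW1.continuous
      simp_rw [hLop]
      exact Continuous.integrable_of_hasCompactSupport (by fun_prop) hc.sq_of.mul_left
    · rw [← integral_const_mul, ← integral_add hξi (hD.const_mul _)]
      refine integral_mono (hmul w hwc hwB) (hξi.add (hD.const_mul _)) fun p => ?_
      have h1 : w p.1 * w (p.1 + p.2) ≤
          fderiv ℝ u p.1 d * fderiv ℝ u (p.1 + p.2) d + 2 * B * L * h := by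
        have e : w p.1 * w (p.1 + p.2) - fderiv ℝ u p.1 d * fderiv ℝ u (p.1 + p.2) d =
          w p.1 * (w (p.1 + p.2) - fderiv ℝ u (p.1 + p.2) d) +
            (w p.1 - fderiv ℝ u p.1 d) * fderiv ℝ u (p.1 + p.2) d := by ring
        have h2 := (le_abs_self _).trans ((abs_mul (w p.1) _).trans_le
          (mul_le_mul (hwB p.1) (hwξ (p.1 + p.2)) (abs_nonneg _) hB0))
        have h3 := (le_abs_self _).trans ((abs_mul _ (fderiv ℝ u (p.1 + p.2) d)).trans_le
          (mul_le_mul (hwξ p.1) (hξ (p.1 + p.2)) (abs_nonneg _) (by positivity)))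
        linarith
      have := mul_le_mul_of_nonneg_right h1 (hD0 p)
      simp only
      linarith
  have hcont : ContinuousAt (fun h : ℝ => 4 * π * (R h * ∫ x, η x ^ 2) +
      ((∫ p : R2 × R2, fderiv ℝ u p.1 d * fderiv ℝ u (p.1 + p.2) d * D p ∂(volume.prod volume)) +
        2 * B * L * h * ∫ p, D p ∂(volume.prod volume)) +
      h ^ 2 * ∫ p, D p ∂(volume.prod volume)) 0 := by
    have : Continuous fun h : ℝ => (B * h) ^ (α:ℝ) :=
      (continuous_const.mul continuous_id).rpow_const fun _ => Or.inr α.2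
    simp only [hR]
    fun_prop
  have hlim := ge_of_tendsto (hcont.tendsto.mono_left nhdsWithin_le_nhds) key
  simpa [hR, zero_rpow hα.ne'] using hlim

/-! ### Directional derivatives do not change sign -/

lemma fderiv_mul_fderiv_nonneg {β : ℝ} (hβ1 : 2/3 < β) (hβ2 : β < 3/2) {v W : ℝ → ℝ}
    (hv : IsVBeta β v) {α : ℝ≥0} (hW : PotentialAssump α W) {u : R2 → ℝ}
    (hu : IsStableSolution β v W u) (d x₀ z₀ : R2) :
    0 ≤ fderiv ℝ u x₀ d * fderiv ℝ u z₀ d := by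
  by_contra! hneg
  wlog hpos : 0 < fderiv ℝ u x₀ d generalizing x₀ z₀
  · refine this z₀ x₀ (by rwa [mul_comm]) ?_
    by_contra! h
    exact absurd hneg (not_lt.2 (mul_nonneg_of_nonpos_of_nonpos (not_lt.1 hpos) h))
  have hz : fderiv ℝ u z₀ d < 0 := by
    by_contra! h
    exact absurd hneg (not_lt.2 (mul_nonneg hpos.le h))
  have hK0 := Kbar_nonneg hβ1 hβ2 hv
  have hvc := hv.1.continuous
  have hK : Integrable fun y => Kbar v y * kap y := integrable_Kbar_weight hv
  obtain ⟨hud, ⟨C, hC⟩, -⟩ := id hu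
  have hC0 : 0 ≤ C := (abs_nonneg _).trans (hC 0).1
  have hξc : Continuous fun x => fderiv ℝ u x d :=
    (hud.continuous_fderiv two_ne_zero).clm_apply continuous_const
  obtain ⟨δ, hδ, hδx, hδz⟩ : ∃ δ : ℝ, 0 < δ ∧ 2 * δ < fderiv ℝ u x₀ d ∧
      fderiv ℝ u z₀ d < -(2 * δ) := by
    refine ⟨min (fderiv ℝ u x₀ d) (-fderiv ℝ u z₀ d) / 4, ?_, ?_, ?_⟩
    · have := lt_min hpos (neg_pos.2 hz)
      positivity
    · linarith [min_le_left (fderiv ℝ u x₀ d) (-fderiv ℝ u z₀ d)]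
    · linarith [min_le_right (fderiv ℝ u x₀ d) (-fderiv ℝ u z₀ d)]
  obtain ⟨r₁, hr₁, hx⟩ := Metric.eventually_nhds_iff.1
    (hξc.continuousAt.eventually (lt_mem_nhds hδx))
  obtain ⟨r₂, hr₂, hz⟩ := Metric.eventually_nhds_iff.1
    (hξc.continuousAt.eventually (gt_mem_nhds hδz))
  obtain ⟨r, hr, hrr₁, hrr₂⟩ : ∃ r : ℝ, 0 < r ∧ r ≤ r₁ ∧ 2 * r ≤ r₂ :=
    ⟨min r₁ (r₂ / 2), by positivity, min_le_left _ _, by linarith [min_le_right r₁ (r₂ / 2)]⟩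
  set Bx := Metric.ball x₀ r
  set By := Metric.ball (z₀ - x₀) r
  have hsum : ∀ x ∈ Bx, ∀ y ∈ By, dist (x + y) z₀ < 2 * r := fun x hx y hy => by
    rw [Metric.mem_ball] at hx hy
    calc dist (x + y) z₀ = dist (x + y) (x₀ + (z₀ - x₀)) := by rw [add_sub_cancel]
      _ ≤ dist x x₀ + dist y (z₀ - x₀) := dist_add_add_le _ _ _ _
      _ < 2 * r := by linarith
  have hf : Integrable (Bx.indicator fun _ : R2 => 4 * δ ^ 2) :=
    (integrableOn_const measure_ball_lt_top.ne).integrable_indicator measurableSet_ball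
  have hg : Integrable (By.indicator fun y => Kbar v y * kap y) := hK.indicator measurableSet_ball
  set m : R2 × R2 → ℝ := fun p => Bx.indicator (fun _ => 4 * δ ^ 2) p.1 *
    By.indicator (fun y => Kbar v y * kap y) p.2 with hmdef
  have hmi : Integrable m (volume.prod volume) := hf.mul_prod hg
  have hm0 : 0 < ∫ p, m p ∂(volume.prod volume) := by
    rw [hmdef, integral_prod_mul (Bx.indicator fun _ : R2 => 4 * δ ^ 2)
      (By.indicator fun y => Kbar v y * kap y)]
    refine mul_pos ?_ ?_
    · rw [integral_indicator measurableSet_ball, setIntegral_const, smul_eq_mul]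
      have : 0 < volume.real Bx :=
        ENNReal.toReal_pos (Metric.measure_ball_pos _ _ hr).ne' measure_ball_lt_top.ne
      positivity
    · rw [integral_pos_iff_support_of_nonneg
        (indicator_nonneg fun y _ => mul_nonneg (hK0 y) (kap_nonneg y)) hg]
      have hsub : By \ {0} ⊆ Function.support (By.indicator fun y => Kbar v y * kap y) := by
        intro y hy
        have hy0 : y ≠ 0 := hy.2
        have : 0 < ‖y‖ := norm_pos_iff.2 hy0
        rw [Function.mem_support, indicator_of_mem hy.1, kap]
        have := Kbar_pos hβ1 hβ2 hv hy0
        positivity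
      refine lt_of_lt_of_le ?_ (measure_mono hsub)
      rw [measure_sdiff_null (measure_singleton _)]
      exact Metric.measure_ball_pos _ _ hr
  obtain ⟨A, hA0, hA⟩ := exists_bound_Kbar_form hβ1 hβ2 hv (hud.of_le one_le_two)
    (fun x => (hC x).1) (fun x => (hC x).2.1) d
  obtain ⟨η, hη, hc, hη0, hη1, hηε⟩ := exists_cutoff (max (‖x₀‖ + r) (‖z₀‖ + 2 * r))
    (ε := (∫ p, m p ∂(volume.prod volume)) / (2 * (A + 1))) (by positivity)
  have hηx : ∀ x ∈ Bx, η x = 1 := fun x hx => hη1 x (le_max_of_le_left (by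
    rw [Metric.mem_ball, dist_eq_norm] at hx
    linarith [norm_le_norm_add_norm_sub' x x₀]))
  have hηz : ∀ x ∈ Bx, ∀ y ∈ By, η (x + y) = 1 := fun x hx y hy => hη1 _ (le_max_of_le_right (by
    have := hsum x hx y hy
    rw [dist_eq_norm] at this
    linarith [norm_le_norm_add_norm_sub' (x + y) z₀]))
  have hlim : ∀ᶠ h in 𝓝[>] (0:ℝ), C * ‖d‖ ^ 2 * h < δ := by
    have : Tendsto (fun h : ℝ => C * ‖d‖ ^ 2 * h) (𝓝[>] 0) (𝓝 (C * ‖d‖ ^ 2 * 0)) :=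
      ((continuous_const_mul _).tendsto 0).mono_left nhdsWithin_le_nhds
    rw [mul_zero] at this
    exact this.eventually (gt_mem_nhds hδ)
  have hle := integral_le_of_stable_fderiv (by linarith) hvc hK hK0 hW hu d hη hc hη0 hmi (by
    filter_upwards [hlim, self_mem_nhdsWithin] with h hhδ hh x y
    rw [mem_Ioi] at hh
    have hw := fun x => abs_le.1 ((abs_diff_quot_sub_fderiv_le hud (fun x => (hC x).2.2) d x
      hh).trans hhδ.le)
    have hrhs : 0 ≤ 2 * (η x * η (x + y)) *
        (|h⁻¹ * (u (x + h • d) - u x) * (h⁻¹ * (u (x + y + h • d) - u (x + y)))| -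
          h⁻¹ * (u (x + h • d) - u x) * (h⁻¹ * (u (x + y + h • d) - u (x + y)))) * Kbar v y :=
      mul_nonneg (mul_nonneg (mul_nonneg two_pos.le (mul_nonneg (hη0 _) (hη0 _)))
        (sub_nonneg.2 (le_abs_self _))) (hK0 y)
    by_cases hxB : x ∈ Bx
    · by_cases hyB : y ∈ By
      · simp only [hmdef, indicator_of_mem hxB, indicator_of_mem hyB, hηx x hxB, hηz x hxB y hyB]
        set a := h⁻¹ * (u (x + h • d) - u x) with ha
        set b := h⁻¹ * (u (x + y + h • d) - u (x + y)) with hb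
        have h1 : δ ≤ a := by linarith [(hw x).1, hx (lt_of_lt_of_le hxB hrr₁)]
        have h2 : b ≤ -δ := by
          linarith [(hw (x + y)).2, hz ((hsum x hxB y hyB).trans_le hrr₂)]
        have h3 : a * b ≤ -δ ^ 2 := by nlinarith
        rw [abs_of_nonpos (by nlinarith)]
        have := mul_le_mul_of_nonneg_left (kap_le_one y) (hK0 y)
        nlinarith [mul_le_mul_of_nonneg_left this (sq_nonneg δ),
          mul_le_mul_of_nonneg_right h3 (hK0 y)]
      · simpa only [hmdef, indicator_of_notMem hyB, mul_zero] using hrhs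
    · simpa only [hmdef, indicator_of_notMem hxB, zero_mul] using hrhs)
  have h1 := hle.trans (hA η (hη.of_le one_le_two) hc)
  have h2 := mul_le_mul_of_nonneg_left hηε hA0
  have h3 : A * ((∫ p, m p ∂(volume.prod volume)) / (2 * (A + 1))) <
      ∫ p, m p ∂(volume.prod volume) := by
    rw [← mul_div_assoc, div_lt_iff₀ (by positivity)]
    nlinarith
  linarith

/-! ### One-dimensional symmetry -/

@[simp] lemma pt_apply_zero (a b : ℝ) : pt a b 0 = a := rfl

@[simp] lemma pt_apply_one (a b : ℝ) : pt a b 1 = b := rfl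

lemma pt_zero_right (s : ℝ) : pt s 0 = s • pt 1 0 := by
  ext i; fin_cases i <;> simp

lemma eq_smul_pt_add_smul_pt (x : R2) : x = x 0 • pt 1 0 + x 1 • pt 0 1 := by
  ext i; fin_cases i <;> simp

lemma eq_zero_of_forall_mul_nonneg {E : Type*} [AddCommGroup E] [Module ℝ E] {L f : E →ₗ[ℝ] ℝ}
    (h : ∀ d, 0 ≤ L d * f d) (hL : L ≠ 0) {d : E} (hd : L d = 0) : f d = 0 := by
  obtain ⟨e, he⟩ : ∃ e, L e ≠ 0 := by
    by_contra! h0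
    exact hL (LinearMap.ext h0)
  by_contra hfd
  have := h (e + (-(f e + L e) / f d) • d)
  simp only [map_add, map_smul, hd, smul_eq_mul, mul_zero, add_zero] at this
  rw [div_mul_cancel₀ _ hfd] at this
  have : 0 < L e ^ 2 := by positivity
  nlinarith

lemma eq_of_fderiv_sub_eq_zero {u : R2 → ℝ} (hu : Differentiable ℝ u) {x z : R2}
    (h : ∀ y, fderiv ℝ u y (x - z) = 0) : u x = u z := by
  have hd : ∀ t : ℝ, HasDerivAt (fun t : ℝ => u (z + t • (x - z))) 0 t := fun t => by
    have := (hu (z + t • (x - z))).hasFDerivAt.comp_hasDerivAt t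
      (((hasDerivAt_id t).smul_const (x - z)).const_add z)
    exact this.congr_deriv (by simp only [one_smul]; exact h _)
  have := is_const_of_deriv_eq_zero (fun t => (hd t).differentiableAt) (fun t => (hd t).deriv) 1 0
  simpa using this

lemma exists_profile {u : R2 → ℝ} (hu : Differentiable ℝ u)
    (htop : Tendsto (fun s => u (pt s 0)) atTop (𝓝 1))
    (hbot : Tendsto (fun s => u (pt s 0)) atBot (𝓝 (-1)))
    (hsign : ∀ d x z, 0 ≤ fderiv ℝ u x d * fderiv ℝ u z d) :
    ∃ a ∈ Ioo (-(π / 2)) (π / 2), ∃ φ : ℝ → ℝ, Monotone φ ∧ (∀ s, φ s ∈ Icc (-1:ℝ) 1) ∧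
      Tendsto φ atTop (𝓝 1) ∧ Tendsto φ atBot (𝓝 (-1)) ∧
      ∀ x : R2, u x = φ (cos a * x 0 + sin a * x 1) := by
  have hder : ∀ s, HasDerivAt (fun s => u (pt s 0)) (fderiv ℝ u (pt s 0) (pt 1 0)) s := fun s => by
    have hp : HasDerivAt (fun s : ℝ => pt s 0) (pt 1 0) s := by
      have h := (hasDerivAt_id s).smul_const (pt 1 0)
      rw [one_smul] at h
      exact h.congr_of_eventuallyEq (.of_forall pt_zero_right)
    exact (hu _).hasFDerivAt.comp_hasDerivAt s hp
  have hdiff : Differentiable ℝ fun s => u (pt s 0) := fun s => (hder s).differentiableAt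
  obtain ⟨x₀, hx₀⟩ : ∃ x₀, 0 < fderiv ℝ u x₀ (pt 1 0) := by
    by_contra! h
    have hanti : Antitone fun s => u (pt s 0) :=
      antitone_of_deriv_nonpos hdiff fun s => (hder s).deriv ▸ h _
    linarith [hanti.le_of_tendsto htop 0, hanti.ge_of_tendsto hbot 0]
  set L := fderiv ℝ u x₀
  have hL : (L : R2 →ₗ[ℝ] ℝ) ≠ 0 := fun h0 => hx₀.ne' (LinearMap.congr_fun h0 (pt 1 0))
  have hmono : Monotone fun s => u (pt s 0) :=
    monotone_of_deriv_nonneg hdiff fun s =>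
      (hder s).deriv ▸ nonneg_of_mul_nonneg_right (hsign (pt 1 0) x₀ _) hx₀
  have hker : ∀ d, L d = 0 → ∀ x, fderiv ℝ u x d = 0 := fun d hd x =>
    eq_zero_of_forall_mul_nonneg (f := (fderiv ℝ u x : R2 →ₗ[ℝ] ℝ))
      (fun d => hsign d x₀ x) hL hd
  set q := L (pt 0 1) / L (pt 1 0)
  have hcos : 0 < cos (arctan q) := cos_arctan_pos q
  have hsin : sin (arctan q) = q * cos (arctan q) := by
    rw [← tan_mul_cos hcos.ne', tan_arctan]
  have h1 : Tendsto (fun s : ℝ => u (pt (s / cos (arctan q)) 0)) atTop (𝓝 1) :=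
    htop.comp (tendsto_id.atTop_div_const hcos)
  have h2 : Tendsto (fun s : ℝ => u (pt (s / cos (arctan q)) 0)) atBot (𝓝 (-1)) :=
    hbot.comp (tendsto_id.atBot_div_const hcos)
  have hφ : Monotone fun s : ℝ => u (pt (s / cos (arctan q)) 0) :=
    hmono.comp fun s t hst => div_le_div_of_nonneg_right hst hcos.le
  refine ⟨arctan q, ⟨neg_pi_div_two_lt_arctan q, arctan_lt_pi_div_two q⟩, _, hφ,
    fun s => ⟨hφ.le_of_tendsto h2 s, hφ.ge_of_tendsto h1 s⟩, h1, h2, fun x => ?_⟩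
  refine eq_of_fderiv_sub_eq_zero hu fun y => hker _ ?_ y
  have hpt : pt ((cos (arctan q) * x 0 + sin (arctan q) * x 1) / cos (arctan q)) 0 =
      (x 0 + q * x 1) • pt 1 0 := by
    rw [pt_zero_right, hsin]
    congr 1
    field_simp
  have hx : L x = x 0 * L (pt 1 0) + x 1 * L (pt 0 1) := by
    conv_lhs => rw [eq_smul_pt_add_smul_pt x]
    simp
  rw [map_sub, hpt, map_smul, hx, smul_eq_mul]
  simp only [q]
  field_simp
  ring

/-- every bounded stable solution has a one-dimensional monotone profile:
`u(x) = φ(e·x)` with `e = (cos α, sin α)`, `α ∈ (−π/2, π/2)`, and `φ` nondecreasing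
with values in `[−1,1]` tending to `±1` at `±∞`; in particular `|u| ≤ 1`. -/
theorem stmt18 (β : ℝ) (hβ1 : 2/3 < β) (hβ2 : β < 3/2) (v : ℝ → ℝ) (hv : IsVBeta β v)
    (W : ℝ → ℝ) (hW : ∃ α : ℝ≥0, PotentialAssump α W) (M : ℝ) (hM : 0 < M)
    (u : R2 → ℝ) (hu : IsStableSolution β v W u) (hub : ∀ x, |u x| ≤ M) :
    (∃ a ∈ Set.Ioo (-(π/2)) (π/2), ∃ φ : ℝ → ℝ,
      Monotone φ ∧ (∀ s, φ s ∈ Set.Icc (-1:ℝ) 1) ∧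
      Tendsto φ atTop (𝓝 1) ∧ Tendsto φ atBot (𝓝 (-1)) ∧
      ∀ x : R2, u x = φ (Real.cos a * x 0 + Real.sin a * x 1)) ∧
    ∀ x : R2, |u x| ≤ 1 := by
  obtain ⟨α, hα⟩ := hW
  obtain ⟨a, ha, φ, hφ, hφI, h1, h2, hux⟩ := exists_profile (hu.1.differentiable two_ne_zero)
    (hu.2.2.2.1 0).1 (hu.2.2.2.1 0).2 (fderiv_mul_fderiv_nonneg hβ1 hβ2 hv hα hu)
  exact ⟨⟨a, ha, φ, hφ, hφI, h1, h2, hux⟩, fun x => hux x ▸ abs_le.2 (hφI _)⟩
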